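/- arXiv:1512.01724 — 5 statements merged into one kernel-verified Lean document; each statement's English description precedes it below -/
import Mathlib

section
/- Let k ≥ 3 with k ≡ 3 (mod 4). Let τ be the homeomorphism of Y(3,k,1) = (C_k)^3 × {1} defined by: τ(0·x', y, z, 1) = (1·x', y, z, 1) and τ(1·x', y, z, 1) = (0·x', y, z, 1) for all x' , y, z ∈ C_k, and τ fixes every point whose first coordinate sequence begins with a symbol ≥ 2. Then τ belongs to 3V_{k,1} and lies in the commutator subgroup D(3V_{k,1}). -/
namespace NV

/-- The Cantor space `C_k = {0,…,k-1}^ℕ` of one-sided infinite sequences. -/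
abbrev Cantor (k : ℕ) : Type := ℕ → Fin k

/-- Concatenation `u·x` of a finite word `u` with an infinite sequence `x`. -/
def concat {k : ℕ} (u : List (Fin k)) (x : Cantor k) : Cantor k :=
  fun i => if h : i < u.length then u.get ⟨i, h⟩ else x (i - u.length)

/-- The space `Y(n,k,r) = (C_k)^n × {1,…,r}`. -/
abbrev Y (n k r : ℕ) : Type := (Fin n → Cantor k) × Fin r

/-- The box `{(u_1·x_1,…,u_n·x_n, a) : x_1,…,x_n ∈ C_k}` determined by
finite words `u_1,…,u_n` and an index `a`. -/
def box {n k r : ℕ} (u : Fin n → List (Fin k)) (a : Fin r) : Set (Y n k r) :=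
  {y | ∃ x : Fin n → Cantor k, y = (fun i => concat (u i) (x i), a)}

/-- A permutation of `Y(n,k,r)` is an element of the higher dimensional Thompson
group `nV_{k,r}` if there are finitely many tuples of words and indices whose domain
boxes partition `Y(n,k,r)`, whose range boxes partition `Y(n,k,r)`, and on which `γ`
acts by the corresponding prefix substitutions. -/
def IsElement {n k r : ℕ} (γ : Equiv.Perm (Y n k r)) : Prop :=
  ∃ (m : ℕ) (u v : Fin m → Fin n → List (Fin k)) (a b : Fin m → Fin r),
    (∀ y : Y n k r, ∃! t : Fin m, y ∈ box (u t) (a t)) ∧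
    (∀ y : Y n k r, ∃! t : Fin m, y ∈ box (v t) (b t)) ∧
    (∀ (t : Fin m) (x : Fin n → Cantor k),
      γ (fun i => concat (u t i) (x i), a t) = (fun i => concat (v t i) (x i), b t))

/-- The underlying set of the higher dimensional Thompson group `nV_{k,r}`,
as a set of permutations of `Y(n,k,r)`. -/
def thompsonSet (n k r : ℕ) : Set (Equiv.Perm (Y n k r)) := {γ | IsElement γ}

end NV

namespace NV

/-- The map on `Fin k` interchanging the symbols `0` and `1` and fixing all
symbols `≥ 2`. -/
def swap01 {k : ℕ} (s : Fin k) : Fin k :=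
  if h : 2 ≤ k then
    if (s : ℕ) = 0 then ⟨1, by omega⟩
    else if (s : ℕ) = 1 then ⟨0, by omega⟩
    else s
  else s

/-- The map `Y(3,k,1) → Y(3,k,1)` sending `(0·x', y, z, 1) ↦ (1·x', y, z, 1)`,
`(1·x', y, z, 1) ↦ (0·x', y, z, 1)`, and fixing every point whose first
coordinate sequence begins with a symbol `≥ 2`. -/
def tauMap (k : ℕ) (p : Y 3 k 1) : Y 3 k 1 :=
  (Function.update p.1 0 (fun m => if m = 0 then swap01 (p.1 0 0) else p.1 0 m), p.2)

end NV

namespace NV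

theorem concat_nil {k : ℕ} (x : Cantor k) : concat [] x = x := by
  funext i; simp [concat]

theorem concat_append {k : ℕ} (u v : List (Fin k)) (x : Cantor k) :
    concat (u ++ v) x = concat u (concat v x) := by
  funext i
  simp only [concat, List.length_append, List.get_eq_getElem]
  by_cases h : i < u.length
  · simp [h, Nat.lt_add_right]
  · have h1 : (i < u.length + v.length) ↔ i - u.length < v.length := by omega
    simp only [h, dite_false, h1, Nat.sub_add_eq]
    split_ifs with h2
    · rw [List.getElem_append_right (by omega)]
    · rfl

theorem concat_injective {k : ℕ} (u : List (Fin k)) : Function.Injective (concat u) := by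
  intro x y h
  funext i
  have := congrFun h (i + u.length)
  simpa [concat] using this

theorem isPrefix_of_concat_eq {k : ℕ} {u w : List (Fin k)} {x y : Cantor k}
    (hl : u.length ≤ w.length) (h : concat w x = concat u y) : u <+: w := by
  rw [List.prefix_iff_getElem]
  refine ⟨hl, fun i hi => ?_⟩
  have := congrFun h i
  simp only [concat, hi, hi.trans_le hl, dite_true, List.get_eq_getElem] at this
  exact this.symm

/-- Prefixing every coordinate by the corresponding word, an embedding of `Y(n,k,r)` onto a union
of boxes, one for each index. -/
def emb {n k r : ℕ} (w : Fin n → List (Fin k)) : Y n k r ↪ Y n k r where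
  toFun p := (fun i => concat (w i) (p.1 i), p.2)
  inj' p q h := by
    simp only [Prod.mk.injEq] at h
    exact Prod.ext (funext fun i => concat_injective _ (congrFun h.1 i)) h.2

theorem emb_append {n k r : ℕ} (u v : Fin n → List (Fin k)) (p : Y n k r) :
    emb (fun i => u i ++ v i) p = emb u (emb v p) :=
  Prod.ext (funext fun i => concat_append (u i) (v i) (p.1 i)) rfl

theorem exists_append_or_notMem_range {n k r : ℕ} {u w : Fin n → List (Fin k)}
    (h : ∀ i, (u i).length ≤ (w i).length) :
    (∃ v : Fin n → List (Fin k), w = fun i => u i ++ v i) ∨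
      ∀ p : Y n k r, emb w p ∉ Set.range (emb u : Y n k r ↪ Y n k r) := by
  by_cases hp : ∀ i, u i <+: w i
  · left
    choose v hv using hp
    exact ⟨v, funext fun i => (hv i).symm⟩
  · right
    rintro p ⟨q, hq⟩
    refine hp fun i => isPrefix_of_concat_eq (h i) (congrFun (congrArg Prod.fst hq) i).symm

/-- A permutation acts by prefix substitution on all sufficiently small boxes. -/
def IsPrefixSubst {n k r : ℕ} (γ : Equiv.Perm (Y n k r)) : Prop :=
  ∃ N : ℕ, ∀ w : Fin n → List (Fin k), (∀ i, N ≤ (w i).length) →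
    ∃ v : Fin n → List (Fin k), ∀ p, γ (emb w p) = emb v p

theorem mem_box_iff {n k r : ℕ} (u : Fin n → List (Fin k)) (a : Fin r) (y : Y n k r) :
    y ∈ box u a ↔ ∃ p : Y n k r, p.2 = a ∧ emb u p = y := by
  constructor
  · rintro ⟨x, rfl⟩
    exact ⟨(x, a), rfl, rfl⟩
  · rintro ⟨p, rfl, rfl⟩
    exact ⟨p.1, rfl⟩

theorem IsPrefixSubst.isElement {n k r : ℕ} {γ : Equiv.Perm (Y n k r)} (h : IsPrefixSubst γ) :
    IsElement γ := by
  obtain ⟨N, hN⟩ := h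
  let ι := (Fin n → Fin N → Fin k) × Fin r
  let e : Fin (Fintype.card ι) ≃ ι := (Fintype.equivFin ι).symm
  let u : Fin (Fintype.card ι) → Fin n → List (Fin k) := fun t i => List.ofFn ((e t).1 i)
  choose v hv using fun t => hN (u t) (fun i => by simp [u])
  have hu : ∀ y : Y n k r, ∃! t, y ∈ box (u t) (e t).2 := by
    intro y
    refine ⟨e.symm (fun i j => y.1 i j, y.2), ?_, ?_⟩
    · refine ⟨fun i j => y.1 i (j + N), Prod.ext ?_ (by simp)⟩
      funext i j
      simp only [concat, u, Equiv.apply_symm_apply, List.length_ofFn, List.get_eq_getElem,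
        List.getElem_ofFn]
      split_ifs with hj
      · rfl
      · rw [Nat.sub_add_cancel (not_lt.mp hj)]
    · rintro t ⟨x, rfl⟩
      rw [Equiv.eq_symm_apply]
      refine Prod.ext ?_ rfl
      funext i j
      simp [concat, u]
  refine ⟨Fintype.card ι, u, v, fun t => (e t).2, fun t => (e t).2, hu, fun y => ?_, fun t x =>
    hv t (x, (e t).2)⟩
  have key : ∀ t, y ∈ box (v t) (e t).2 ↔ γ.symm y ∈ box (u t) (e t).2 := by
    intro t
    simp only [mem_box_iff, ← hv, Equiv.eq_symm_apply]
  simpa only [key] using hu (γ.symm y)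

section Swap

variable {X : Type*}

/-- The permutation interchanging the images of two embeddings with disjoint ranges. -/
noncomputable def swapEmb (e f : X ↪ X) (h : ∀ p q, e p ≠ f q) : Equiv.Perm X :=
  Equiv.Perm.viaEmbedding (Equiv.sumComm X X)
    ⟨Sum.elim e f, e.injective.sumElim f.injective h⟩

variable {e f : X ↪ X} (h : ∀ p q, e p ≠ f q)

theorem swapEmb_left (p : X) : swapEmb e f h (e p) = f p :=
  Equiv.Perm.viaEmbedding_apply (Equiv.sumComm X X) ⟨Sum.elim e f, _⟩ (Sum.inl p)

theorem swapEmb_right (p : X) : swapEmb e f h (f p) = e p :=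
  Equiv.Perm.viaEmbedding_apply (Equiv.sumComm X X) ⟨Sum.elim e f, _⟩ (Sum.inr p)

theorem swapEmb_of_notMem {x : X} (he : x ∉ Set.range e) (hf : x ∉ Set.range f) :
    swapEmb e f h x = x := by
  apply Equiv.Perm.viaEmbedding_apply_of_notMem
  rintro ⟨p | p, hp⟩
  exacts [he ⟨p, hp⟩, hf ⟨p, hp⟩]

theorem eq_swapEmb {π : Equiv.Perm X} (h1 : ∀ p, π (e p) = f p) (h2 : ∀ p, π (f p) = e p)
    (h3 : ∀ x, x ∉ Set.range e → x ∉ Set.range f → π x = x) : π = swapEmb e f h := by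
  ext x
  by_cases he : x ∈ Set.range e
  · obtain ⟨p, rfl⟩ := he
    rw [h1, swapEmb_left]
  by_cases hf : x ∈ Set.range f
  · obtain ⟨p, rfl⟩ := hf
    rw [h2, swapEmb_right]
  rw [h3 x he hf, swapEmb_of_notMem h he hf]

theorem swapEmb_comm : swapEmb e f h = swapEmb f e (fun p q => (h q p).symm) :=
  eq_swapEmb _ (swapEmb_right h) (swapEmb_left h) fun _ h1 h2 => swapEmb_of_notMem h h2 h1

theorem swapEmb_mul_self : swapEmb e f h * swapEmb e f h = 1 := by
  ext x
  simp only [Equiv.Perm.mul_apply, Equiv.Perm.one_apply]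
  by_cases he : x ∈ Set.range e
  · obtain ⟨p, rfl⟩ := he
    rw [swapEmb_left, swapEmb_right]
  by_cases hf : x ∈ Set.range f
  · obtain ⟨p, rfl⟩ := hf
    rw [swapEmb_right, swapEmb_left]
  rw [swapEmb_of_notMem h he hf, swapEmb_of_notMem h he hf]

theorem mul_viaEmbedding_mul_inv {Z : Type*} (g : Equiv.Perm Z) {e f : Z ↪ X} {s : Equiv.Perm X}
    (hs : ∀ p, s (e p) = f p) : s * g.viaEmbedding e * s⁻¹ = g.viaEmbedding f := by
  ext x
  obtain ⟨y, rfl⟩ := s.surjective x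
  rw [Equiv.Perm.mul_apply, Equiv.Perm.mul_apply, Equiv.Perm.inv_def, Equiv.symm_apply_apply]
  by_cases hy : y ∈ Set.range e
  · obtain ⟨p, rfl⟩ := hy
    rw [Equiv.Perm.viaEmbedding_apply, hs, hs, Equiv.Perm.viaEmbedding_apply]
  · rw [Equiv.Perm.viaEmbedding_apply_of_notMem _ _ _ hy,
      Equiv.Perm.viaEmbedding_apply_of_notMem]
    rintro ⟨p, hp⟩
    rw [← hs, s.injective.eq_iff] at hp
    exact hy ⟨p, hp⟩

theorem viaEmbedding_viaEmbedding {Z W : Type*} (g : Equiv.Perm Z) (e : Z ↪ W) (f : W ↪ X) :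
    (g.viaEmbedding e).viaEmbedding f = g.viaEmbedding (e.trans f) := by
  ext x
  by_cases hf : x ∈ Set.range f
  · obtain ⟨y, rfl⟩ := hf
    rw [Equiv.Perm.viaEmbedding_apply]
    by_cases he : y ∈ Set.range e
    · obtain ⟨z, rfl⟩ := he
      rw [Equiv.Perm.viaEmbedding_apply]
      exact (Equiv.Perm.viaEmbedding_apply g (e.trans f) z).symm
    · rw [Equiv.Perm.viaEmbedding_apply_of_notMem _ _ _ he,
        Equiv.Perm.viaEmbedding_apply_of_notMem]
      rintro ⟨z, hz⟩
      exact he ⟨z, f.injective hz⟩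
  · rw [Equiv.Perm.viaEmbedding_apply_of_notMem _ _ _ hf,
      Equiv.Perm.viaEmbedding_apply_of_notMem]
    rintro ⟨z, hz⟩
    exact hf ⟨e z, hz⟩

theorem mul_swapEmb_mul_inv {e' f' : X ↪ X} {s : Equiv.Perm X} (h' : ∀ p q, e' p ≠ f' q)
    (he : ∀ p, s (e p) = e' p) (hf : ∀ p, s (f p) = f' p) :
    s * swapEmb e f h * s⁻¹ = swapEmb e' f' h' := by
  apply mul_viaEmbedding_mul_inv
  rintro (p | p)
  exacts [he p, hf p]

end Swap

theorem exists_length_le {n k : ℕ} (u : Fin n → List (Fin k)) : ∃ N, ∀ i, (u i).length ≤ N :=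
  ⟨Finset.univ.sup fun i => (u i).length,
    fun i => Finset.le_sup (f := fun i => (u i).length) (Finset.mem_univ i)⟩

theorem isPrefixSubst_swapEmb {n k r : ℕ} {u v : Fin n → List (Fin k)}
    (h : ∀ p q : Y n k r, emb u p ≠ emb v q) : IsPrefixSubst (swapEmb (emb u) (emb v) h) := by
  obtain ⟨M, hM⟩ := exists_length_le u
  obtain ⟨N, hN⟩ := exists_length_le v
  refine ⟨max M N, fun w hw => ?_⟩
  rcases exists_append_or_notMem_range (r := r)
    fun i => (hM i).trans ((le_max_left M N).trans (hw i)) with ⟨w', rfl⟩ | hu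
  · exact ⟨fun i => v i ++ w' i, fun p => by rw [emb_append, emb_append, swapEmb_left]⟩
  rcases exists_append_or_notMem_range (r := r)
    fun i => (hN i).trans ((le_max_right M N).trans (hw i)) with ⟨w', rfl⟩ | hv
  · exact ⟨fun i => u i ++ w' i, fun p => by rw [emb_append, emb_append, swapEmb_right]⟩
  exact ⟨w, fun p => swapEmb_of_notMem h (hu p) (hv p)⟩

theorem IsPrefixSubst.viaEmbedding {n k r : ℕ} {g : Equiv.Perm (Y n k r)} (hg : IsPrefixSubst g)
    (u : Fin n → List (Fin k)) : IsPrefixSubst (g.viaEmbedding (emb u)) := by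
  obtain ⟨M, hM⟩ := exists_length_le u
  obtain ⟨N, hN⟩ := hg
  refine ⟨M + N, fun w hw => ?_⟩
  rcases exists_append_or_notMem_range (r := r)
    fun i => (hM i).trans ((Nat.le_add_right M N).trans (hw i)) with ⟨w', rfl⟩ | hu
  · obtain ⟨v, hv⟩ := hN w' fun i => by
      have := hw i
      have := hM i
      simp only [List.length_append] at *
      omega
    exact ⟨fun i => u i ++ v i, fun p => by
      rw [emb_append, emb_append, Equiv.Perm.viaEmbedding_apply, hv]⟩
  · exact ⟨w, fun p => Equiv.Perm.viaEmbedding_apply_of_notMem _ _ _ (hu p)⟩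

/-- The tuple of words with `l` in position `d` and empty words elsewhere. -/
def single {n k : ℕ} (d : Fin n) (l : List (Fin k)) : Fin n → List (Fin k) :=
  Function.update (fun _ => []) d l

theorem concat_singleton_zero {k : ℕ} (i : Fin k) (x : Cantor k) : concat [i] x 0 = i := rfl

theorem concat_singleton_tail {k : ℕ} (x : Cantor k) : concat [x 0] (fun j => x (j + 1)) = x := by
  funext j
  cases j <;> simp [concat]

theorem emb_single {n k r : ℕ} (d : Fin n) (l : List (Fin k)) (p : Y n k r) :
    emb (single d l) p = (Function.update p.1 d (concat l (p.1 d)), p.2) := by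
  refine Prod.ext ?_ rfl
  funext i
  by_cases h : i = d
  · subst h; simp [emb, single]
  · simp [emb, single, h, concat_nil]

/-- Splitting off the first symbol of the coordinate `d`. -/
noncomputable def splitEquiv {n k r : ℕ} (d : Fin n) : Fin k × Y n k r ≃ Y n k r :=
  Equiv.ofBijective (fun q => emb (single d [q.1]) q.2) <| by
    constructor
    · rintro ⟨i, p⟩ ⟨j, q⟩ h
      have hij : i = j := by
        have := congrFun (congrFun (congrArg Prod.fst h) d) 0
        simpa [emb_single, concat_singleton_zero] using this
      subst hij
      exact Prod.ext rfl ((emb _).injective h)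
    · intro p
      refine ⟨(p.1 d 0, (Function.update p.1 d fun j => p.1 d (j + 1), p.2)), ?_⟩
      simp [emb_single, concat_singleton_tail]

theorem splitEquiv_apply {n k r : ℕ} (d : Fin n) (i : Fin k) (p : Y n k r) :
    splitEquiv d (i, p) = emb (single d [i]) p := rfl

theorem splitEquiv_symm_emb {n k r : ℕ} (d : Fin n) (i : Fin k) (p : Y n k r) :
    (splitEquiv d).symm (emb (single d [i]) p) = (i, p) := by
  rw [← splitEquiv_apply, Equiv.symm_apply_apply]

theorem exists_emb_single {n k r : ℕ} (d : Fin n) (p : Y n k r) :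
    ∃ i q, p = emb (single d [i]) q :=
  ⟨_, _, ((splitEquiv d).apply_symm_apply p).symm⟩

theorem emb_single_comm {n k r : ℕ} {d e : Fin n} (h : d ≠ e) (l m : List (Fin k)) (p : Y n k r) :
    emb (single d l) (emb (single e m) p) = emb (single e m) (emb (single d l) p) := by
  simp only [emb_single]
  rw [Function.update_of_ne h, Function.update_of_ne h.symm, Function.update_comm h]

/-- The baker-type map moving the first symbol of the coordinate `d` to the coordinate `e`. -/
noncomputable def baker {n : ℕ} (k r : ℕ) (d e : Fin n) : Equiv.Perm (Y n k r) :=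
  (splitEquiv d).symm.trans (splitEquiv e)

theorem baker_emb {n k r : ℕ} (d e : Fin n) (i : Fin k) (p : Y n k r) :
    baker k r d e (emb (single d [i]) p) = emb (single e [i]) p := by
  simp [baker, splitEquiv_symm_emb, splitEquiv_apply]

theorem isPrefixSubst_baker {n k r : ℕ} (d e : Fin n) : IsPrefixSubst (baker k r d e) := by
  refine ⟨1, fun w hw => ?_⟩
  obtain ⟨i, l, hl⟩ := List.exists_cons_of_length_pos (hw d)
  have hw' : w = fun j => single d [i] j ++ Function.update w d l j := by
    funext j
    by_cases h : j = d
    · subst h; simp [single, hl]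
    · simp [single, h]
  refine ⟨fun j => single e [i] j ++ Function.update w d l j, fun p => ?_⟩
  rw [emb_append, ← baker_emb d e, ← emb_append, ← hw']

/-- The permutation acting as `g i` on the part where the coordinate `d` starts with `i`. -/
noncomputable def blockPerm {n k r : ℕ} (d : Fin n) (g : Fin k → Equiv.Perm (Y n k r)) :
    Equiv.Perm (Y n k r) :=
  (splitEquiv d).permCongr (Equiv.prodCongrRight g)

theorem blockPerm_emb {n k r : ℕ} (d : Fin n) (g : Fin k → Equiv.Perm (Y n k r)) (i : Fin k)
    (p : Y n k r) : blockPerm d g (emb (single d [i]) p) = emb (single d [i]) (g i p) := by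
  simp [blockPerm, Equiv.permCongr_apply, splitEquiv_symm_emb, splitEquiv_apply]

theorem emb_single_ne {n k r : ℕ} (d : Fin n) {i j : Fin k} (h : i ≠ j) (p q : Y n k r) :
    emb (single d [i]) p ≠ emb (single d [j]) q := fun hpq => h <|
  congrArg Prod.fst ((splitEquiv d).injective (a₁ := (i, p)) (a₂ := (j, q)) hpq)

theorem blockPerm_insert {n k r : ℕ} (d : Fin n) (g : Equiv.Perm (Y n k r)) {i : Fin k}
    {S : Finset (Fin k)} (hi : i ∉ S) :
    blockPerm d (fun j => if j ∈ insert i S then g else 1) =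
      g.viaEmbedding (emb (single d [i])) * blockPerm d (fun j => if j ∈ S then g else 1) := by
  ext1 x
  obtain ⟨j, p, rfl⟩ := exists_emb_single d x
  rw [Equiv.Perm.mul_apply, blockPerm_emb, blockPerm_emb]
  by_cases hj : j = i
  · subst hj
    simp [hi, Equiv.Perm.viaEmbedding_apply]
  · rw [Equiv.Perm.viaEmbedding_apply_of_notMem]
    · simp [hj]
    · rintro ⟨q, hq⟩
      exact emb_single_ne d (Ne.symm hj) _ _ hq

theorem baker_eq_blockPerm {n k r : ℕ} {d e c : Fin n} (hd : c ≠ d) (he : c ≠ e) :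
    baker k r d e = blockPerm c fun _ => baker k r d e := by
  ext1 x
  obtain ⟨i, p, rfl⟩ := exists_emb_single c x
  obtain ⟨j, p, rfl⟩ := exists_emb_single d p
  rw [blockPerm_emb, baker_emb, emb_single_comm hd, baker_emb, emb_single_comm he]

/-- The embedding of the sub-boxes of depth two in the coordinate `d`. -/
noncomputable def pairEmb {n : ℕ} (k r : ℕ) (d : Fin n) : (Fin k × Fin k) × Y n k r ↪ Y n k r :=
  ((Equiv.prodAssoc _ _ _).trans
    ((Equiv.prodCongr (Equiv.refl _) (splitEquiv d)).trans (splitEquiv d))).toEmbedding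

theorem pairEmb_apply {n k r : ℕ} (d : Fin n) (i j : Fin k) (p : Y n k r) :
    pairEmb k r d ((i, j), p) = emb (single d [i]) (emb (single d [j]) p) := rfl

/-- Permuting the copies of `Z` inside `X` given by an embedding of `ι × Z`. -/
noncomputable def permCopies {ι Z X : Type*} (e : ι × Z ↪ X) : Equiv.Perm ι →* Equiv.Perm X where
  toFun π := Equiv.Perm.viaEmbedding (π.prodCongr (Equiv.refl Z)) e
  map_one' := by
    rw [← Equiv.Perm.viaEmbeddingHom_apply]
    exact map_one _
  map_mul' a b := by
    simp only [← Equiv.Perm.viaEmbeddingHom_apply, ← map_mul]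
    rfl

theorem permCopies_apply {ι Z X : Type*} (e : ι × Z ↪ X) (π : Equiv.Perm ι) (i : ι) (z : Z) :
    permCopies e π (e (i, z)) = e (π i, z) :=
  Equiv.Perm.viaEmbedding_apply _ e (i, z)

theorem permCopies_of_notMem {ι Z X : Type*} (e : ι × Z ↪ X) (π : Equiv.Perm ι) {x : X}
    (hx : x ∉ Set.range e) : permCopies e π x = x :=
  Equiv.Perm.viaEmbedding_apply_of_notMem _ e x hx

theorem baker_eq_blockPerm_mul {n k r : ℕ} {d e : Fin n} (h : d ≠ e) :
    baker k r d e = blockPerm d (fun _ => baker k r d e) *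
      permCopies (pairEmb k r d) (Equiv.prodComm _ _) := by
  ext1 x
  obtain ⟨i, p, rfl⟩ := exists_emb_single d x
  obtain ⟨j, p, rfl⟩ := exists_emb_single d p
  rw [Equiv.Perm.mul_apply, ← pairEmb_apply, permCopies_apply, Equiv.prodComm_apply, Prod.swap,
    pairEmb_apply, pairEmb_apply, blockPerm_emb, baker_emb, baker_emb, emb_single_comm h]

theorem permCopies_swap {ι X : Type*} [DecidableEq ι] (e : ι × X ↪ X) {i j : ι} {u v : X ↪ X}
    (hu : ∀ p, e (i, p) = u p) (hv : ∀ p, e (j, p) = v p) (h : ∀ p q, u p ≠ v q) :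
    permCopies e (Equiv.swap i j) = swapEmb u v h := by
  apply eq_swapEmb
  · intro p; rw [← hu, permCopies_apply, Equiv.swap_apply_left, hv]
  · intro p; rw [← hv, permCopies_apply, Equiv.swap_apply_right, hu]
  · intro x h1 h2
    by_cases hx : x ∈ Set.range e
    · obtain ⟨⟨l, p⟩, rfl⟩ := hx
      rw [permCopies_apply, Equiv.swap_apply_of_ne_of_ne]
      · rintro rfl; exact h1 ⟨p, (hu p).symm⟩
      · rintro rfl; exact h2 ⟨p, (hv p).symm⟩
    · exact permCopies_of_notMem e _ hx

theorem sign_prodComm_of_mod_four {k : ℕ} (hk : k % 4 = 3) :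
    Equiv.Perm.sign (Equiv.prodComm (Fin k) (Fin k)) = -1 := by
  have hsq : (Equiv.prodComm (Fin k) (Fin k) : Equiv.Perm (Fin k × Fin k)) ^ 2 = 1 := by
    ext1 x
    simp [pow_two, Equiv.Perm.mul_apply]
  have hfix : Fintype.card (Function.fixedPoints (Equiv.prodComm (Fin k) (Fin k))) = k := by
    let f : Fin k ≃ Function.fixedPoints (Equiv.prodComm (Fin k) (Fin k)) :=
      { toFun := fun i => ⟨(i, i), rfl⟩
        invFun := fun x => x.1.1
        left_inv := fun _ => rfl
        right_inv := by
          rintro ⟨⟨i, j⟩, hij⟩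
          obtain rfl : j = i := congrArg Prod.fst hij
          rfl }
    rw [← Fintype.card_congr f, Fintype.card_fin]
  rw [Equiv.Perm.sign_of_pow_two_eq_one hsq, hfix, Fintype.card_prod, Fintype.card_fin]
  apply Odd.neg_one_pow
  obtain ⟨m, rfl⟩ : ∃ m, k = 4 * m + 3 := ⟨k / 4, by omega⟩
  refine ⟨4 * m ^ 2 + 5 * m + 1, ?_⟩
  have : (4 * m + 3) * (4 * m + 3) - (4 * m + 3) = 2 * (2 * (4 * m ^ 2 + 5 * m + 1) + 1) := by
    rw [Nat.sub_eq_iff_eq_add (Nat.le_mul_self _)]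
    ring
  rw [this, Nat.mul_div_cancel_left _ two_pos]

section HasClass

variable {X : Type*} {G : Subgroup (Equiv.Perm X)}

/-- The permutation `x` belongs to `G` and has image `a` in the abelianization of `G`. -/
def HasClass (G : Subgroup (Equiv.Perm X)) (x : Equiv.Perm X) (a : Abelianization G) : Prop :=
  ∃ h : x ∈ G, Abelianization.of (⟨x, h⟩ : G) = a

variable {x y s : Equiv.Perm X} {a b : Abelianization G}

theorem hasClass_of_mem (h : x ∈ G) : HasClass G x (Abelianization.of ⟨x, h⟩) := ⟨h, rfl⟩

theorem hasClass_one : HasClass G 1 1 := ⟨G.one_mem, map_one _⟩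

theorem HasClass.mul (hx : HasClass G x a) (hy : HasClass G y b) : HasClass G (x * y) (a * b) := by
  obtain ⟨hx, rfl⟩ := hx
  obtain ⟨hy, rfl⟩ := hy
  exact ⟨G.mul_mem hx hy, map_mul Abelianization.of (⟨x, hx⟩ : G) ⟨y, hy⟩⟩

theorem HasClass.inv (hx : HasClass G x a) : HasClass G x⁻¹ a⁻¹ := by
  obtain ⟨hx, rfl⟩ := hx
  exact ⟨G.inv_mem hx, map_inv Abelianization.of (⟨x, hx⟩ : G)⟩

theorem HasClass.unique (hx : HasClass G x a) (hy : HasClass G x b) : a = b :=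
  hx.2.symm.trans hy.2

theorem HasClass.conj (hs : s ∈ G) (hx : HasClass G x a) : HasClass G (s * x * s⁻¹) a := by
  simpa [mul_comm] using ((hasClass_of_mem hs).mul hx).mul (hasClass_of_mem hs).inv

theorem HasClass.viaEmbedding_of_disjoint {e f : X ↪ X} (h : ∀ p q, e p ≠ f q)
    (hs : swapEmb e f h ∈ G) {g : Equiv.Perm X} (hg : HasClass G (g.viaEmbedding e) a) :
    HasClass G (g.viaEmbedding f) a := by
  rw [← mul_viaEmbedding_mul_inv g (swapEmb_left h)]
  exact hg.conj hs

theorem HasClass.swapEmb_symm {u v : X ↪ X} {h : ∀ p q, u p ≠ v q}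
    (hx : HasClass G (swapEmb u v h) a) :
    HasClass G (swapEmb v u fun p q => (h q p).symm) a :=
  swapEmb_comm h ▸ hx

theorem HasClass.swapEmb_replace {u v w : X ↪ X} {huv : ∀ p q, u p ≠ v q}
    (hx : HasClass G (swapEmb u v huv) a) (huw : ∀ p q, u p ≠ w q) (hwv : ∀ p q, w p ≠ v q)
    (hs : swapEmb u w huw ∈ G) : HasClass G (swapEmb w v hwv) a := by
  rw [← mul_swapEmb_mul_inv huv (s := swapEmb u w huw) hwv (swapEmb_left huw) fun p =>
    swapEmb_of_notMem huw (fun ⟨q, hq⟩ => huv q p hq) (fun ⟨q, hq⟩ => hwv q p hq)]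
  exact hx.conj hs

end HasClass

section Thompson

variable {n k r : ℕ} {G : Subgroup (Equiv.Perm (Y n k r))}

theorem hasClass_blockPerm_viaEmbedding {a : Abelianization G} {d : Fin n}
    {g : Equiv.Perm (Y n k r)} {e : Y n k r ↪ Y n k r}
    (h : ∀ i, HasClass G (g.viaEmbedding ((emb (single d [i])).trans e)) a) :
    HasClass G ((blockPerm d fun _ => g).viaEmbedding e) (a ^ k) := by
  have key : ∀ S : Finset (Fin k),
      HasClass G ((blockPerm d fun j => if j ∈ S then g else 1).viaEmbedding e) (a ^ S.card) := by
    intro S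
    induction S using Finset.induction_on with
    | empty =>
      have h1 : (blockPerm d fun _ => 1 : Equiv.Perm (Y n k r)) = 1 := by
        ext1 x
        obtain ⟨j, p, rfl⟩ := exists_emb_single d x
        rw [blockPerm_emb]
        rfl
      simpa [h1, ← Equiv.Perm.viaEmbeddingHom_apply] using hasClass_one
    | insert i S hi ih =>
      rw [blockPerm_insert d g hi, ← Equiv.Perm.viaEmbeddingHom_apply, map_mul,
        Equiv.Perm.viaEmbeddingHom_apply, Equiv.Perm.viaEmbeddingHom_apply,
        viaEmbedding_viaEmbedding, Finset.card_insert_of_notMem hi, pow_succ']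
      exact (h i).mul ih
  simpa using key Finset.univ

theorem hasClass_permCopies {ι : Type*} [Fintype ι] [DecidableEq ι] {X : Type*}
    {G : Subgroup (Equiv.Perm X)} {t : Abelianization G} {e : ι × X ↪ X}
    (h : ∀ i j, i ≠ j → HasClass G (permCopies e (Equiv.swap i j)) t) (π : Equiv.Perm ι) :
    ∃ m : ℕ, HasClass G (permCopies e π) (t ^ m) ∧ Equiv.Perm.sign π = (-1) ^ m := by
  induction π using Equiv.Perm.swap_induction_on with
  | one => exact ⟨0, by simpa using hasClass_one, by simp⟩
  | swap_mul π i j hij ih =>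
    obtain ⟨m, hm, hs⟩ := ih
    refine ⟨m + 1, ?_, ?_⟩
    · rw [map_mul, pow_succ']
      exact (h i j hij).mul hm
    · rw [Equiv.Perm.sign_mul, Equiv.Perm.sign_swap hij, hs, pow_succ']

theorem permCopies_viaEmbedding {ι Z W X : Type*} (e : ι × Z ↪ W) (f : W ↪ X)
    (π : Equiv.Perm ι) :
    (permCopies e π).viaEmbedding f = permCopies (e.trans f) π :=
  viaEmbedding_viaEmbedding _ e f

/-- For `k % 4 = 3`, the transposition of two first symbols of the coordinate `d` is trivial in
the abelianization as soon as there are two further coordinates. -/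
theorem hasClass_swapEmb_one (hG : ∀ γ, IsPrefixSubst γ → γ ∈ G) (hk4 : k % 4 = 3)
    {d e c : Fin n} (hde : d ≠ e) (hcd : c ≠ d) (hce : c ≠ e) {i₀ i₁ i₂ : Fin k}
    (h01 : i₀ ≠ i₁) (h02 : i₀ ≠ i₂) (h12 : i₁ ≠ i₂) :
    HasClass G (swapEmb (emb (single d [i₀])) (emb (single d [i₁])) (emb_single_ne d h01)) 1 := by
  have hswap : ∀ (u v : Fin n → List (Fin k)) (h : ∀ p q : Y n k r, emb u p ≠ emb v q),
      swapEmb (emb u) (emb v) h ∈ G := fun u v h => hG _ (isPrefixSubst_swapEmb h)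
  have happ : ∀ u v : Fin n → List (Fin k), ((emb u).trans (emb v) : Y n k r ↪ Y n k r) =
      emb fun i => v i ++ u i := fun u v => by ext1 p; exact (emb_append v u p).symm
  obtain ⟨t, ht⟩ : ∃ t, HasClass G (swapEmb (emb (single d [i₀])) (emb (single d [i₁]))
      (emb_single_ne d h01)) t := ⟨_, hasClass_of_mem (hswap _ _ _)⟩
  obtain ⟨b, hb⟩ : ∃ b, HasClass G ((baker k r d e).viaEmbedding (emb (single d [i₁]))) b :=
    ⟨_, hasClass_of_mem (hG _ ((isPrefixSubst_baker d e).viaEmbedding _))⟩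
  -- all copies of the baker map and all transpositions inside the box of `i₀` have the same class
  have hb₀ : HasClass G ((baker k r d e).viaEmbedding (emb (single d [i₀]))) b :=
    hb.viaEmbedding_of_disjoint (emb_single_ne d h01.symm) (hswap _ _ _)
  have hb' : ∀ c i, HasClass G ((baker k r d e).viaEmbedding
      ((emb (single c [i])).trans (emb (single d [i₀])))) b := fun c i => by
    have hne : ∀ p q : Y n k r, emb (single d [i₁]) p ≠
        ((emb (single c [i])).trans (emb (single d [i₀]))) q :=
      fun p q => emb_single_ne d h01.symm p _
    refine hb.viaEmbedding_of_disjoint hne ?_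
    simp only [happ]
    exact hswap _ _ _
  have hbk := hasClass_blockPerm_viaEmbedding (hb' c)
  rw [← baker_eq_blockPerm hcd hce] at hbk
  have hbd := hasClass_blockPerm_viaEmbedding (hb' d)
  have hbb : b = b ^ k := hb₀.unique hbk
  rw [← hbb] at hbd
  have ht' : ∀ (u v : Fin n → List (Fin k))
      (h : ∀ p q : Y n k r, emb (single d [i₀]) (emb u p) ≠ emb (single d [i₀]) (emb v q)),
      HasClass G (swapEmb ((emb u).trans (emb (single d [i₀])))
        ((emb v).trans (emb (single d [i₀]))) h) t := by
    intro u v h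
    have h2 := ht.swapEmb_symm.swapEmb_replace (w := emb (single d [i₂]))
      (emb_single_ne d h12) (emb_single_ne d h02.symm) (hswap _ _ _)
    have h3 := h2.swapEmb_symm.swapEmb_replace (w := emb (single d [i₁]))
      (emb_single_ne d h01) (emb_single_ne d h12) (hswap _ _ _)
    have h4 := h3.swapEmb_symm.swapEmb_replace (w := (emb u).trans (emb (single d [i₀])))
      (fun p q => emb_single_ne d h02.symm _ _) (fun p q => emb_single_ne d h01 _ _)
      (by simp only [happ]; exact hswap _ _ _)
    have h5 := h4.swapEmb_symm.swapEmb_replace (w := (emb v).trans (emb (single d [i₀])))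
      (fun p q => emb_single_ne d h01.symm _ _) (fun p q => (h q p).symm)
      (by simp only [happ]; exact hswap _ _ _)
    exact h5.swapEmb_symm
  obtain ⟨m, hm, hsign⟩ := hasClass_permCopies (t := t)
    (e := (pairEmb k r d).trans (emb (single d [i₀]))) (fun i j hij => by
      have hne : ∀ p q : Y n k r, emb (fun l => single d [i.1] l ++ single d [i.2] l) p ≠
          emb (fun l => single d [j.1] l ++ single d [j.2] l) q := by
        intro p q hpq
        rw [emb_append, emb_append, ← pairEmb_apply, ← pairEmb_apply] at hpq
        exact hij (congrArg Prod.fst ((pairEmb k r d).injective hpq))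
      rw [permCopies_swap _ (u := (emb _).trans (emb (single d [i₀])))
        (v := (emb _).trans (emb (single d [i₀]))) _ _
        fun p q hpq => hne p q ((emb (single d [i₀])).injective hpq)]
      · exact ht' _ _ _
      · intro p
        simp only [Function.Embedding.trans_apply, emb_append]
        rfl
      · intro p
        simp only [Function.Embedding.trans_apply, emb_append]
        rfl) (Equiv.prodComm (Fin k) (Fin k))
  rw [sign_prodComm_of_mod_four hk4] at hsign
  have hodd : Odd m := by
    by_contra hm'
    rw [Nat.not_odd_iff_even] at hm'
    rw [hm'.neg_one_pow] at hsign
    exact absurd hsign (by decide)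
  have hprod := hbd.mul hm
  rw [← permCopies_viaEmbedding, ← Equiv.Perm.viaEmbeddingHom_apply,
    ← Equiv.Perm.viaEmbeddingHom_apply, ← map_mul, ← baker_eq_blockPerm_mul hde,
    Equiv.Perm.viaEmbeddingHom_apply] at hprod
  have htm : t ^ m = 1 := by simpa using hb₀.unique hprod
  have ht2 : t * t = 1 := by
    have := ht.mul ht
    rw [swapEmb_mul_self] at this
    exact this.unique hasClass_one
  obtain ⟨l, rfl⟩ := hodd
  rw [pow_succ, pow_mul, pow_two, ht2, one_pow, one_mul] at htm
  rwa [htm] at ht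

end Thompson

end NV

theorem statement11 (k : ℕ) (hk : 3 ≤ k) (hk4 : k % 4 = 3)
    (G : Subgroup (Equiv.Perm (NV.Y 3 k 1)))
    (hG : (G : Set (Equiv.Perm (NV.Y 3 k 1))) = NV.thompsonSet 3 k 1)
    (τ : Equiv.Perm (NV.Y 3 k 1))
    (hτ : ∀ p : NV.Y 3 k 1, τ p = NV.tauMap k p) :
    ∃ h : τ ∈ G, (⟨τ, h⟩ : ↥G) ∈ commutator ↥G := by
  have hmem : ∀ γ, NV.IsPrefixSubst γ → γ ∈ G := fun γ hγ => by
    rw [← SetLike.mem_coe, hG]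
    exact hγ.isElement
  have h01 : (⟨0, by omega⟩ : Fin k) ≠ ⟨1, by omega⟩ := by simp
  have h02 : (⟨0, by omega⟩ : Fin k) ≠ ⟨2, by omega⟩ := by simp
  have h12 : (⟨1, by omega⟩ : Fin k) ≠ ⟨2, by omega⟩ := by simp
  have hτ' : ∀ i p, τ (NV.emb (NV.single 0 [i]) p) = NV.emb (NV.single 0 [NV.swap01 i]) p := by
    intro i p
    rw [hτ, NV.tauMap, NV.emb_single, NV.emb_single]
    simp only [Function.update_self, Function.update_idem, NV.concat_singleton_zero]
    congr 2
    funext m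
    cases m <;> simp [NV.concat]
  have hclass := NV.hasClass_swapEmb_one hmem hk4 (d := 0) (e := 1) (c := 2) (by decide)
    (by decide) (by decide) h01 h02 h12
  rw [← NV.eq_swapEmb (π := τ)] at hclass
  · obtain ⟨h, h1⟩ := hclass
    refine ⟨h, ?_⟩
    rwa [← Abelianization.ker_of, MonoidHom.mem_ker]
  · intro p
    rw [hτ']
    simp [NV.swap01, show 2 ≤ k by omega]
  · intro p
    rw [hτ']
    simp [NV.swap01, show 2 ≤ k by omega]
  · intro x h0 h1
    obtain ⟨i, p, rfl⟩ := NV.exists_emb_single 0 x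
    rw [hτ']
    have hi0 : (i : ℕ) ≠ 0 := fun hi => by
      have : (⟨0, by omega⟩ : Fin k) = i := Fin.ext hi.symm
      exact h0 ⟨p, by rw [this]⟩
    have hi1 : (i : ℕ) ≠ 1 := fun hi => by
      have : (⟨1, by omega⟩ : Fin k) = i := Fin.ext hi.symm
      exact h1 ⟨p, by rw [this]⟩
    simp [NV.swap01, hi0, hi1]
end

section
/- Let n ≥ 2, let k : {1,…,n} → {2,3,…} be constant with value k ≥ 2, and let r ≥ 1. Then the higher dimensional Thompson group nV_{k,r} is isomorphic to the subgroup W(n,k)^{(r)} := {γ ∈ W(n,k) : γ(z,j) = (z,j) for all z ∈ Z(n,k) and all j > r} of W(n,k). -/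
namespace WGroup

/-- The space `Z(n,k) × ℕ`, where `Z(n,k) = C_{k(1)} × ⋯ × C_{k(n)}` is the product
of Cantor spaces and the second factor indexes the copies.  (Indices are taken in
Lean's `ℕ`, i.e. starting from `0` rather than `1`.) -/
abbrev Sp (n : ℕ) (k : Fin n → ℕ) : Type := (∀ d : Fin n, ℕ → Fin (k d)) × ℕ

/-- The defining formula for the generator `s_{i,d}`:
`s_{i,d}(z,j) = (z,j)` for `j < i`; `s_{i,d}(z,i) = (σ_d(z), i + z^{(d)}_1)`; and
`s_{i,d}(z,j) = (z, j + k(d) - 1)` for `j > i`. -/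
def sMap {n : ℕ} (k : Fin n → ℕ) (i : ℕ) (d : Fin n) (p : Sp n k) : Sp n k :=
  if p.2 < i then p
  else if p.2 = i then
    (Function.update p.1 d (fun m => p.1 d (m + 1)), i + (p.1 d 0 : ℕ))
  else (p.1, p.2 + (k d - 1))

/-- The defining formula for the generator `τ_i`: it interchanges `(z,i)` and
`(z,i+1)` and fixes all other points. -/
def tMap {n : ℕ} (k : Fin n → ℕ) (i : ℕ) (p : Sp n k) : Sp n k :=
  if p.2 = i then (p.1, i + 1)
  else if p.2 = i + 1 then (p.1, i)
  else p

/-- The generating set `{s_{i,d}, τ_i : i ∈ ℕ, 1 ≤ d ≤ n}` of `W(n,k)`. -/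
def gens {n : ℕ} (k : Fin n → ℕ) (s : ℕ → Fin n → Equiv.Perm (Sp n k))
    (t : ℕ → Equiv.Perm (Sp n k)) : Set (Equiv.Perm (Sp n k)) :=
  {g | ∃ i d, g = s i d} ∪ {g | ∃ i, g = t i}

end WGroup

namespace WGroup

/-- The subgroup of permutations of `Z(n,k) × ℕ` fixing every point `(z,j)` with
`j` beyond the first `r` indices (with `0`-based indexing: `j ≥ r`). -/
def fixedBeyond {n : ℕ} (k : Fin n → ℕ) (r : ℕ) : Subgroup (Equiv.Perm (Sp n k)) where
  carrier := {γ | ∀ p : Sp n k, r ≤ p.2 → γ p = p}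
  one_mem' := by intro p _; rfl
  mul_mem' := by
    intro a b ha hb p hp
    have h1 := hb p hp
    have h2 := ha p hp
    calc (a * b) p = a (b p) := rfl
      _ = a p := by rw [h1]
      _ = p := h2
  inv_mem' := by
    intro a ha p hp
    have h := ha p hp
    calc a⁻¹ p = a⁻¹ (a p) := by rw [h]
      _ = p := a.symm_apply_apply p

end WGroup

namespace BoxMaps

open WGroup

/-- Coordinatewise concatenation of a tuple of words with a tuple of sequences. -/
def app {n k : ℕ} (u : Fin n → List (Fin k)) (z : Fin n → NV.Cantor k) : Fin n → NV.Cantor k :=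
  fun i => NV.concat (u i) (z i)

/-- The tuple of words consisting of the single letter `e` in direction `d`. -/
def letter {n k : ℕ} (d : Fin n) (e : Fin k) : Fin n → List (Fin k) :=
  Function.update (fun _ => []) d [e]

/-- The shift `σ_d`. -/
def shift {n k : ℕ} (d : Fin n) (z : Fin n → NV.Cantor k) : Fin n → NV.Cantor k :=
  Function.update z d (fun m => z d (m + 1))

lemma concat_nil {k : ℕ} (x : NV.Cantor k) : NV.concat [] x = x := by
  funext i
  simp [NV.concat]

lemma concat_cons_zero {k : ℕ} (e : Fin k) (u : List (Fin k)) (x : NV.Cantor k) :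
    NV.concat (e :: u) x 0 = e := by
  simp [NV.concat]

lemma concat_cons_succ {k : ℕ} (e : Fin k) (u : List (Fin k)) (x : NV.Cantor k) (i : ℕ) :
    NV.concat (e :: u) x (i + 1) = NV.concat u x i := by
  simp [NV.concat]

lemma concat_append {k : ℕ} (u v : List (Fin k)) (x : NV.Cantor k) :
    NV.concat (u ++ v) x = NV.concat u (NV.concat v x) := by
  induction u with
  | nil => simp [concat_nil]
  | cons e u ih =>
    funext i
    cases i with
    | zero => simp [concat_cons_zero]
    | succ i => simp [concat_cons_succ, ih]

lemma concat_cons_tail {k : ℕ} (x : NV.Cantor k) :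
    NV.concat [x 0] (fun m => x (m + 1)) = x := by
  funext i
  cases i with
  | zero => simp [concat_cons_zero]
  | succ i => simp [concat_cons_succ, concat_nil]

lemma exists_concat_eq {k : ℕ} (N : ℕ) (x : NV.Cantor k) :
    ∃ (u : List (Fin k)) (y : NV.Cantor k), u.length = N ∧ NV.concat u y = x := by
  induction N generalizing x with
  | zero => exact ⟨[], x, rfl, concat_nil x⟩
  | succ N ih =>
    obtain ⟨u, y, hu, hy⟩ := ih (fun m => x (m + 1))
    refine ⟨x 0 :: u, y, by simp [hu], ?_⟩
    rw [← List.singleton_append, concat_append, hy, concat_cons_tail]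

lemma exists_append_of_concat_eq {k : ℕ} {u v : List (Fin k)} {x y : NV.Cantor k}
    (h : NV.concat u x = NV.concat v y) (hl : u.length ≤ v.length) : ∃ p, v = u ++ p := by
  induction u generalizing v with
  | nil => exact ⟨v, rfl⟩
  | cons e u ih =>
    cases v with
    | nil => simp at hl
    | cons f v =>
      have h0 := congrFun h 0
      rw [concat_cons_zero, concat_cons_zero] at h0
      obtain ⟨p, rfl⟩ := ih (v := v) (by
        funext i
        simpa only [concat_cons_succ] using congrFun h (i + 1)) (by simpa using hl)
      exact ⟨p, by simp [h0]⟩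

lemma concat_inj_of_length_eq {k : ℕ} {u v : List (Fin k)} {x y : NV.Cantor k}
    (h : NV.concat u x = NV.concat v y) (hl : u.length = v.length) : u = v := by
  obtain ⟨p, rfl⟩ := exists_append_of_concat_eq h hl.le
  simpa using hl

variable {n k : ℕ}

lemma app_nil (z : Fin n → NV.Cantor k) : app (fun _ => []) z = z := by
  funext i
  simp [app, concat_nil]

lemma app_app (u p : Fin n → List (Fin k)) (z : Fin n → NV.Cantor k) :
    app u (app p z) = app (fun i => u i ++ p i) z := by
  funext i
  simp [app, concat_append]

lemma app_letter_zero (d : Fin n) (e : Fin k) (z : Fin n → NV.Cantor k) :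
    app (letter d e) z d 0 = e := by
  simp [letter, app, concat_cons_zero]

lemma shift_app_of_cons {d : Fin n} {w : Fin n → List (Fin k)} {e : Fin k} {l : List (Fin k)}
    (h : w d = e :: l) (z : Fin n → NV.Cantor k) :
    shift d (app w z) = app (Function.update w d l) z := by
  funext i
  by_cases hi : i = d
  · subst hi; simp [shift, app, h, concat_cons_succ]
  · simp [shift, app, hi]

lemma app_zero_of_cons {d : Fin n} {w : Fin n → List (Fin k)} {e : Fin k} {l : List (Fin k)}
    (h : w d = e :: l) (z : Fin n → NV.Cantor k) : app w z d 0 = e := by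
  simp [app, h, concat_cons_zero]

lemma shift_app_letter (d : Fin n) (e : Fin k) (z : Fin n → NV.Cantor k) :
    shift d (app (letter d e) z) = z := by
  have h : letter d e d = [e] := by simp [letter]
  rw [shift_app_of_cons h]
  convert app_nil z using 2
  simp [letter]

lemma exists_app_eq (N : ℕ) (z : Fin n → NV.Cantor k) :
    ∃ (u : Fin n → List (Fin k)) (y : Fin n → NV.Cantor k),
      (∀ i, (u i).length = N) ∧ app u y = z := by
  choose u y hu hy using fun i => exists_concat_eq N (z i)
  exact ⟨u, y, hu, funext hy⟩

lemma sMap_of_lt {i j : ℕ} (d : Fin n) (z : Fin n → NV.Cantor k) (h : j < i) :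
    sMap (fun _ => k) i d (z, j) = (z, j) := by
  simp [sMap, h]

lemma sMap_self (i : ℕ) (d : Fin n) (z : Fin n → NV.Cantor k) :
    sMap (fun _ => k) i d (z, i) = (shift d z, i + (z d 0 : ℕ)) := by
  simp only [sMap, lt_irrefl, if_false, if_true]
  rfl

lemma sMap_of_gt {i j : ℕ} (d : Fin n) (z : Fin n → NV.Cantor k) (h : i < j) :
    sMap (fun _ => k) i d (z, j) = (z, j + (k - 1)) := by
  simp [sMap, h.not_gt, h.ne']

/-- Splitting every column `j ∈ A`, `j < J`, once in direction `d` is an element of any group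
containing the generators `s i d`. -/
lemma exists_split (hk : 1 ≤ k) {H : Subgroup (Equiv.Perm (Sp n fun _ => k))} (d : Fin n)
    (hH : ∀ i, ∃ g ∈ H, ∀ p, g p = sMap (fun _ => k) i d p) (A : Set ℕ) (J : ℕ) :
    ∃ D ∈ H, ∃ (o : ℕ → ℕ) (J' : ℕ),
      (∀ j < J, ∀ z, j ∈ A → D (z, j) = (shift d z, o j + (z d 0 : ℕ))) ∧
      (∀ j < J, ∀ z, j ∉ A → D (z, j) = (z, o j)) ∧
      (∀ i z, D (z, J + i) = (z, J' + i)) := by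
  classical
  induction J with
  | zero => exact ⟨1, H.one_mem, id, 0, by simp, by simp, by simp⟩
  | succ J ih =>
    obtain ⟨D, hD, o, J', h1, h2, h3⟩ := ih
    by_cases hJ : J ∈ A
    · obtain ⟨g, hg, hgs⟩ := hH J
      refine ⟨D * g, H.mul_mem hD hg, Function.update o J J', J' + k, ?_, ?_, ?_⟩
      · intro j hj z hA
        rw [Equiv.Perm.mul_apply, hgs]
        rcases Nat.lt_succ_iff_lt_or_eq.mp hj with hj | rfl
        · rw [sMap_of_lt d z hj, h1 j hj z hA, Function.update_of_ne hj.ne]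
        · rw [sMap_self, h3, Function.update_self]
      · intro j hj z hA
        rw [Equiv.Perm.mul_apply, hgs]
        rcases Nat.lt_succ_iff_lt_or_eq.mp hj with hj | rfl
        · rw [sMap_of_lt d z hj, h2 j hj z hA, Function.update_of_ne hj.ne]
        · exact absurd hJ hA
      · intro i z
        rw [Equiv.Perm.mul_apply, hgs, sMap_of_gt d z (by omega),
          show J + 1 + i + (k - 1) = J + (k + i) by omega, h3, add_assoc]
    · refine ⟨D, hD, Function.update o J J', J' + 1, ?_, ?_, ?_⟩
      · intro j hj z hA
        rcases Nat.lt_succ_iff_lt_or_eq.mp hj with hj | rfl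
        · rw [h1 j hj z hA, Function.update_of_ne hj.ne]
        · exact absurd hA hJ
      · intro j hj z hA
        rcases Nat.lt_succ_iff_lt_or_eq.mp hj with hj | rfl
        · rw [h2 j hj z hA, Function.update_of_ne hj.ne]
        · simpa using h3 0 z
      · intro i z
        rw [add_assoc, h3, add_assoc]

/-- The columns of the inverse of a splitting. -/
lemma split_column {D : Equiv.Perm (Sp n fun _ => k)} {d : Fin n} {A : Set ℕ} {J J' : ℕ}
    {o : ℕ → ℕ} (z₀ : Fin n → NV.Cantor k)
    (h1 : ∀ j < J, ∀ z, j ∈ A → D (z, j) = (shift d z, o j + (z d 0 : ℕ)))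
    (h2 : ∀ j < J, ∀ z, j ∉ A → D (z, j) = (z, o j))
    (h3 : ∀ i z, D (z, J + i) = (z, J' + i)) {l : ℕ} (hl : l < J') :
    ∃ j < J, (j ∈ A ∧ ∃ e, ∀ z, D⁻¹ (z, l) = (app (letter d e) z, j)) ∨
      (j ∉ A ∧ ∀ z, D⁻¹ (z, l) = (z, j)) := by
  obtain ⟨⟨y, j⟩, hy⟩ := D.surjective (z₀, l)
  have hj : j < J := by
    by_contra hj
    obtain ⟨i, rfl⟩ := Nat.exists_eq_add_of_le (not_lt.mp hj)
    rw [h3] at hy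
    have := congrArg Prod.snd hy
    simp at this
    omega
  refine ⟨j, hj, ?_⟩
  by_cases hA : j ∈ A
  · refine Or.inl ⟨hA, y d 0, fun z => ?_⟩
    rw [Equiv.Perm.inv_eq_iff_eq, h1 j hj _ hA, shift_app_letter, app_letter_zero]
    rw [h1 j hj _ hA] at hy
    exact Prod.ext rfl (congrArg Prod.snd hy).symm
  · refine Or.inr ⟨hA, fun z => ?_⟩
    rw [Equiv.Perm.inv_eq_iff_eq, h2 j hj _ hA]
    rw [h2 j hj _ hA] at hy
    exact Prod.ext rfl (congrArg Prod.snd hy).symm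

/-- `f` is a shift of columns far out, and substitutes prefixes of length at most `M` for the
prefixes of length `N` in the first columns. -/
def IsLevel (N M : Fin n → ℕ) (f : Equiv.Perm (Sp n fun _ => k)) : Prop :=
  ∃ J R : ℕ, (∀ i z, f (z, J + i) = (z, R + i)) ∧
    ∀ j < J, ∀ u : Fin n → List (Fin k), (∀ i, (u i).length = N i) →
      ∃ (v : Fin n → List (Fin k)) (b : ℕ), (∀ i, (v i).length ≤ M i) ∧
        ∀ z, f (app u z, j) = (app v z, b)

lemma swap_mem {K : Subgroup (Equiv.Perm ℕ)} (hK : ∀ i, Equiv.swap i (i + 1) ∈ K) (a m : ℕ) :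
    Equiv.swap a (a + m) ∈ K := by
  induction m with
  | zero =>
    rw [add_zero, Equiv.swap_self]
    exact K.one_mem
  | succ m ih =>
    rcases Nat.eq_zero_or_pos m with rfl | hm
    · exact hK a
    · have := Equiv.swap_mul_swap_mul_swap (x := a + m + 1) (y := a + m) (z := a) (by omega)
        (by omega)
      rw [add_assoc] at this
      rw [← this, Equiv.swap_comm (a + m) a, Equiv.swap_comm (a + (m + 1))]
      exact K.mul_mem (K.mul_mem ih (hK _)) ih

lemma mem_of_fixes_above {K : Subgroup (Equiv.Perm ℕ)} (hK : ∀ i, Equiv.swap i (i + 1) ∈ K)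
    (J : ℕ) (π : Equiv.Perm ℕ) (hπ : ∀ i, J ≤ i → π i = i) : π ∈ K := by
  induction J generalizing π with
  | zero => rw [show π = 1 from Equiv.ext fun i => hπ i i.zero_le]; exact K.one_mem
  | succ J ih =>
    have hle : π J ≤ J := by
      by_contra h
      have := π.injective (hπ (π J) (by omega))
      omega
    obtain ⟨m, hm⟩ := Nat.exists_eq_add_of_le hle
    have hs : Equiv.swap (π J) J ∈ K := by
      have := swap_mem hK (π J) m
      rwa [← hm] at this
    rw [← K.mul_mem_cancel_left hs]
    refine ih _ fun i hi => ?_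
    rw [Equiv.Perm.mul_apply]
    rcases Nat.eq_or_lt_of_le hi with rfl | hi
    · rw [Equiv.swap_apply_left]
    · rw [hπ i hi, Equiv.swap_apply_of_ne_of_ne (by omega) (by omega)]

/-- The action of permutations of the set of columns. -/
def columnHom (n k : ℕ) : Equiv.Perm ℕ →* Equiv.Perm (Sp n fun _ => k) where
  toFun π := Equiv.prodCongr (Equiv.refl _) π
  map_one' := rfl
  map_mul' _ _ := rfl

lemma columnHom_apply (π : Equiv.Perm ℕ) (z : Fin n → NV.Cantor k) (j : ℕ) :
    columnHom n k π (z, j) = (z, π j) := rfl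

lemma columnHom_swap (i : ℕ) (p : Sp n fun _ => k) :
    columnHom n k (Equiv.swap i (i + 1)) p = tMap (fun _ => k) i p := by
  obtain ⟨z, j⟩ := p
  rw [columnHom_apply, Equiv.swap_apply_def]
  simp only [tMap]
  split_ifs <;> rfl

section

variable {H : Subgroup (Equiv.Perm (Sp n fun _ => k))}

lemma mem_of_isLevel_zero_zero (z₀ : Fin n → NV.Cantor k)
    (hτ : ∀ i, columnHom n k (Equiv.swap i (i + 1)) ∈ H)
    {f : Equiv.Perm (Sp n fun _ => k)} (hf : IsLevel 0 0 f) : f ∈ H := by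
  obtain ⟨J, R, h1, h2⟩ := hf
  have hcol : ∀ j, ∃ b, ∀ z, f (z, j) = (z, b) := by
    intro j
    rcases lt_or_ge j J with hj | hj
    · obtain ⟨v, b, hv, h⟩ := h2 j hj (fun _ => []) (by simp)
      obtain rfl : v = fun _ => [] := funext fun i => by simpa using hv i
      exact ⟨b, fun z => by simpa only [app_nil] using h z⟩
    · obtain ⟨i, rfl⟩ := Nat.exists_eq_add_of_le hj
      exact ⟨R + i, h1 i⟩
  choose q hq using hcol
  have hinj : Function.Injective q := fun a b hab => by
    have : f (z₀, a) = f (z₀, b) := by rw [hq, hq, hab]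
    exact congrArg Prod.snd (f.injective this)
  have hsurj : Function.Surjective q := fun b => by
    obtain ⟨⟨z, j⟩, h⟩ := f.surjective (z₀, b)
    rw [hq] at h
    exact ⟨j, congrArg Prod.snd h⟩
  have hqJ : ∀ i, q (J + i) = R + i := fun i => by
    have := h1 i z₀
    rw [hq] at this
    exact congrArg Prod.snd this
  have hJR : (Finset.range J).image q = Finset.range R := by
    ext b
    simp only [Finset.mem_image, Finset.mem_range]
    constructor
    · rintro ⟨j, hj, rfl⟩
      by_contra hb
      obtain ⟨i, hi⟩ := Nat.exists_eq_add_of_le (not_lt.mp hb)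
      rw [← hqJ] at hi
      have := hinj hi
      omega
    · intro hb
      obtain ⟨j, rfl⟩ := hsurj b
      refine ⟨j, ?_, rfl⟩
      by_contra hj
      obtain ⟨i, rfl⟩ := Nat.exists_eq_add_of_le (not_lt.mp hj)
      rw [hqJ] at hb
      omega
  have hcard := congrArg Finset.card hJR
  rw [Finset.card_image_of_injective _ hinj, Finset.card_range, Finset.card_range] at hcard
  subst hcard
  have hf : f = columnHom n k (Equiv.ofBijective q ⟨hinj, hsurj⟩) := by
    ext1 ⟨z, j⟩
    rw [columnHom_apply, hq]
    rfl
  rw [hf]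
  refine mem_of_fixes_above (K := H.comap (columnHom n k)) hτ J _ fun i hi => ?_
  obtain ⟨i, rfl⟩ := Nat.exists_eq_add_of_le hi
  exact hqJ i

lemma exists_isLevel_zero_right (hk : 1 ≤ k)
    (hσ : ∀ i d, ∃ g ∈ H, ∀ p, g p = sMap (fun _ => k) i d p)
    (z₀ : Fin n → NV.Cantor k) {M : Fin n → ℕ} {d : Fin n}
    (hd : 0 < M d) {f : Equiv.Perm (Sp n fun _ => k)} (hf : IsLevel 0 M f) :
    ∃ T ∈ H, ∃ D ∈ H, IsLevel 0 (Function.update M d (M d - 1)) (T * f * D⁻¹) := by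
  obtain ⟨J, R, h1, h2⟩ := hf
  have h2' : ∀ j, ∃ (v : Fin n → List (Fin k)) (b : ℕ), j < J → (∀ i, (v i).length ≤ M i) ∧
      ∀ z, f (z, j) = (app v z, b) := by
    intro j
    by_cases hj : j < J
    · obtain ⟨v, b, hv, h⟩ := h2 j hj (fun _ => []) (by simp)
      exact ⟨v, b, fun _ => ⟨hv, fun z => by simpa only [app_nil] using h z⟩⟩
    · exact ⟨fun _ => [], 0, fun h => absurd h hj⟩
  choose v b hvb using h2'
  have hbR : ∀ j < J, b j < R := by
    intro j hj
    by_contra hb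
    obtain ⟨i, hi⟩ := Nat.exists_eq_add_of_le (not_lt.mp hb)
    have h := (hvb j hj).2 z₀
    rw [hi, ← h1] at h
    have := congrArg Prod.snd (f.injective h)
    simp at this
    omega
  obtain ⟨D, hD, o, J', hD1, hD2, hD3⟩ :=
    exists_split hk d (fun i => hσ i d) {j | v j d = []} J
  obtain ⟨T, hT, o', R', hT1, -, hT3⟩ := exists_split hk d (fun i => hσ i d) Set.univ R
  refine ⟨T, hT, D, hD, J', R', ?_, ?_⟩
  · intro i z
    rw [Equiv.Perm.mul_apply, Equiv.Perm.mul_apply,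
      (Equiv.Perm.inv_eq_iff_eq).mpr (hD3 i z).symm, h1, hT3]
  · intro l hl u hu
    obtain rfl : u = fun _ => [] := funext fun i => by simpa using hu i
    obtain ⟨c, w, hcR, hwd, hwM, hw⟩ : ∃ (c : ℕ) (w : Fin n → List (Fin k)), c < R ∧ w d ≠ [] ∧
        (∀ i, (w i).length ≤ M i) ∧ ∀ z, f (D⁻¹ (z, l)) = (app w z, c) := by
      obtain ⟨j, hj, ⟨hA, e, he⟩ | ⟨hA, he⟩⟩ := split_column z₀ hD1 hD2 hD3 hl
      · refine ⟨b j, fun i => v j i ++ letter d e i, hbR j hj, by simp [letter], ?_, ?_⟩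
        · intro i
          by_cases hi : i = d
          · subst hi
            rw [Set.mem_ofPred_eq] at hA
            simp [letter, hA]
            omega
          · simpa [letter, hi] using (hvb j hj).1 i
        · intro z
          rw [he, (hvb j hj).2, app_app]
      · exact ⟨b j, v j, hbR j hj, hA, (hvb j hj).1, fun z => by rw [he, (hvb j hj).2]⟩
    obtain ⟨e, tl, hetl⟩ := List.exists_cons_of_ne_nil hwd
    refine ⟨Function.update w d tl, o' c + (e : ℕ), ?_, ?_⟩
    · intro i
      by_cases hi : i = d
      · subst hi
        have := hwM i
        rw [hetl, List.length_cons] at this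
        simp
        omega
      · simpa [hi] using hwM i
    · intro z
      rw [app_nil, Equiv.Perm.mul_apply, Equiv.Perm.mul_apply, hw, hT1 c hcR _ trivial,
        shift_app_of_cons hetl, app_zero_of_cons hetl]

lemma exists_isLevel_left (hk : 1 ≤ k)
    (hσ : ∀ i d, ∃ g ∈ H, ∀ p, g p = sMap (fun _ => k) i d p)
    (z₀ : Fin n → NV.Cantor k) {N M : Fin n → ℕ} {d : Fin n}
    (hd : 0 < N d) {f : Equiv.Perm (Sp n fun _ => k)} (hf : IsLevel N M f) :
    ∃ D ∈ H, IsLevel (Function.update N d (N d - 1)) M (f * D⁻¹) := by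
  obtain ⟨J, R, h1, h2⟩ := hf
  obtain ⟨D, hD, o, J', hD1, hD2, hD3⟩ := exists_split hk d (fun i => hσ i d) Set.univ J
  refine ⟨D, hD, J', R, ?_, ?_⟩
  · intro i z
    rw [Equiv.Perm.mul_apply, (Equiv.Perm.inv_eq_iff_eq).mpr (hD3 i z).symm, h1]
  · intro l hl u hu
    obtain ⟨j, hj, ⟨-, e, he⟩ | ⟨hA, -⟩⟩ := split_column z₀ hD1 hD2 hD3 hl
    · obtain ⟨v, b, hv, h⟩ := h2 j hj (fun i => letter d e i ++ u i) (by
        intro i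
        have := hu i
        by_cases hi : i = d
        · subst hi
          simp [letter] at this ⊢
          omega
        · simpa [letter, hi] using this)
      refine ⟨v, b, hv, fun z => ?_⟩
      rw [Equiv.Perm.mul_apply, he, app_app, h]
    · exact absurd trivial hA

lemma mem_of_isLevel (hk : 1 ≤ k)
    (hσ : ∀ i d, ∃ g ∈ H, ∀ p, g p = sMap (fun _ => k) i d p) (z₀ : Fin n → NV.Cantor k)
    (hτ : ∀ i, columnHom n k (Equiv.swap i (i + 1)) ∈ H)
    {N M : Fin n → ℕ} {f : Equiv.Perm (Sp n fun _ => k)} (hf : IsLevel N M f) : f ∈ H := by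
  have hdec : ∀ (L : Fin n → ℕ) (d : Fin n), 0 < L d →
      ∑ i, Function.update L d (L d - 1) i < ∑ i, L i := by
    intro L d hd
    refine Finset.sum_lt_sum (fun i _ => ?_) ⟨d, Finset.mem_univ d, by simp; omega⟩
    by_cases hi : i = d
    · subst hi; simp
    · simp [hi]
  have hpos : ∀ L : Fin n → ℕ, L ≠ 0 → ∃ d, 0 < L d := fun L hL => by
    obtain ⟨d, hd⟩ := Function.ne_iff.mp hL
    exact ⟨d, Nat.pos_of_ne_zero hd⟩
  have hzero : ∀ (m : ℕ) (M : Fin n → ℕ), ∑ i, M i = m →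
      ∀ f : Equiv.Perm (Sp n fun _ => k), IsLevel 0 M f → f ∈ H := by
    intro m
    induction m using Nat.strong_induction_on with
    | _ m ih =>
      rintro M rfl f hf
      by_cases hM : M = 0
      · subst hM
        exact mem_of_isLevel_zero_zero z₀ hτ hf
      · obtain ⟨d, hd⟩ := hpos M hM
        obtain ⟨T, hT, D, hD, h⟩ := exists_isLevel_zero_right hk hσ z₀ hd hf
        have := ih _ (hdec M d hd) _ rfl _ h
        rwa [H.mul_mem_cancel_right (H.inv_mem hD), H.mul_mem_cancel_left hT] at this
  induction hm : ∑ i, N i using Nat.strong_induction_on generalizing N f with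
  | _ m ih =>
    subst hm
    by_cases hN : N = 0
    · subst hN
      exact hzero _ M rfl f hf
    · obtain ⟨d, hd⟩ := hpos N hN
      obtain ⟨D, hD, h⟩ := exists_isLevel_left hk hσ z₀ hd hf
      have := ih _ (hdec N d hd) h rfl
      rwa [H.mul_mem_cancel_right (H.inv_mem hD)] at this

end

/-- `f` substitutes prefixes for all prefixes of length at least `N`. -/
def IsUniform (N : ℕ) (f : Equiv.Perm (Sp n fun _ => k)) : Prop :=
  ∀ (j : ℕ) (u : Fin n → List (Fin k)), (∀ i, N ≤ (u i).length) →
    ∃ (v : Fin n → List (Fin k)) (b : ℕ), ∀ z, f (app u z, j) = (app v z, b)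

lemma IsUniform.mul {N₁ N₂ : ℕ} {f g : Equiv.Perm (Sp n fun _ => k)}
    (hf : IsUniform N₁ f) (hg : IsUniform N₂ g) : IsUniform (N₁ + N₂) (f * g) := by
  intro j u hu
  obtain ⟨v, b, hv⟩ := hg j (fun i => (u i).take N₂) fun i => by
    have := hu i
    simp only [List.length_take]
    omega
  obtain ⟨w, c, hw⟩ := hf b (fun i => v i ++ (u i).drop N₂) fun i => by
    have := hu i
    simp only [List.length_append, List.length_drop]
    omega
  refine ⟨w, c, fun z => ?_⟩
  have hz : app u z = app (fun i => (u i).take N₂) (app (fun i => (u i).drop N₂) z) := by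
    rw [app_app]
    simp only [List.take_append_drop]
  rw [Equiv.Perm.mul_apply, hz, hv, app_app, hw]

lemma isUniform_one : IsUniform 0 (1 : Equiv.Perm (Sp n fun _ => k)) :=
  fun j u _ => ⟨u, j, fun _ => rfl⟩

lemma isUniform_of_tMap {f : Equiv.Perm (Sp n fun _ => k)} {i : ℕ}
    (hf : ∀ p, f p = tMap (fun _ => k) i p) : IsUniform 0 f := by
  intro j u _
  refine ⟨u, Equiv.swap i (i + 1) j, fun z => ?_⟩
  rw [hf, ← columnHom_swap, columnHom_apply]

lemma isUniform_inv_of_tMap {f : Equiv.Perm (Sp n fun _ => k)} {i : ℕ}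
    (hf : ∀ p, f p = tMap (fun _ => k) i p) : IsUniform 0 f⁻¹ := by
  have : f = columnHom n k (Equiv.swap i (i + 1)) :=
    Equiv.ext fun p => by rw [hf, columnHom_swap]
  rw [this, ← map_inv, Equiv.swap_inv, ← this]
  exact isUniform_of_tMap hf

lemma isUniform_of_sMap {f : Equiv.Perm (Sp n fun _ => k)} {i : ℕ} {d : Fin n}
    (hf : ∀ p, f p = sMap (fun _ => k) i d p) : IsUniform 1 f := by
  intro j u hu
  rcases lt_trichotomy j i with hj | rfl | hj
  · exact ⟨u, j, fun z => by rw [hf, sMap_of_lt d _ hj]⟩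
  · obtain ⟨e, l, hl⟩ := List.exists_cons_of_length_pos (hu d)
    exact ⟨_, _, fun z => by rw [hf, sMap_self, shift_app_of_cons hl, app_zero_of_cons hl]⟩
  · exact ⟨u, _, fun z => by rw [hf, sMap_of_gt d _ hj]⟩

lemma isUniform_inv_of_sMap (z₀ : Fin n → NV.Cantor k) {f : Equiv.Perm (Sp n fun _ => k)} {i : ℕ}
    {d : Fin n} (hf : ∀ p, f p = sMap (fun _ => k) i d p) : IsUniform 0 f⁻¹ := by
  intro l u _
  obtain ⟨⟨y, j⟩, hy⟩ := f.surjective (z₀, l)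
  rw [hf] at hy
  rcases lt_trichotomy j i with hj | rfl | hj
  · rw [sMap_of_lt d _ hj] at hy
    refine ⟨u, j, fun z => ?_⟩
    rw [Equiv.Perm.inv_eq_iff_eq, hf, sMap_of_lt d _ hj, (Prod.mk.inj hy).2]
  · rw [sMap_self] at hy
    refine ⟨fun i => letter d (y d 0) i ++ u i, j, fun z => ?_⟩
    rw [Equiv.Perm.inv_eq_iff_eq, hf, sMap_self, ← app_app, shift_app_letter, app_letter_zero,
      (Prod.mk.inj hy).2]
  · rw [sMap_of_gt d _ hj] at hy
    refine ⟨u, j, fun z => ?_⟩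
    rw [Equiv.Perm.inv_eq_iff_eq, hf, sMap_of_gt d _ hj, (Prod.mk.inj hy).2]

lemma exists_isUniform_of_mem_closure (z₀ : Fin n → NV.Cantor k)
    {s : ℕ → Fin n → Equiv.Perm (Sp n fun _ => k)} {t : ℕ → Equiv.Perm (Sp n fun _ => k)}
    (hs : ∀ i d p, s i d p = sMap (fun _ => k) i d p) (ht : ∀ i p, t i p = tMap (fun _ => k) i p)
    {f : Equiv.Perm (Sp n fun _ => k)} (hf : f ∈ Subgroup.closure (gens (fun _ => k) s t)) :
    ∃ N, IsUniform N f := by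
  induction hf using Subgroup.closure_induction'' with
  | mem x hx =>
    rcases hx with ⟨i, d, rfl⟩ | ⟨i, rfl⟩
    · exact ⟨1, isUniform_of_sMap (hs i d)⟩
    · exact ⟨0, isUniform_of_tMap (ht i)⟩
  | inv_mem x hx =>
    rcases hx with ⟨i, d, rfl⟩ | ⟨i, rfl⟩
    · exact ⟨0, isUniform_inv_of_sMap z₀ (hs i d)⟩
    · exact ⟨0, isUniform_inv_of_tMap (ht i)⟩
  | one => exact ⟨0, isUniform_one⟩
  | mul x y _ _ hx hy =>
    obtain ⟨N₁, h₁⟩ := hx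
    obtain ⟨N₂, h₂⟩ := hy
    exact ⟨N₁ + N₂, h₁.mul h₂⟩

/-- `Y(n,k,r)` as the union of the first `r` columns. -/
def columnsEquiv (n k r : ℕ) : NV.Y n k r ≃ {p : Sp n fun _ => k // p.2 < r} where
  toFun y := ⟨(y.1, y.2), y.2.2⟩
  invFun p := (p.1.1, ⟨p.1.2, p.2⟩)
  left_inv _ := rfl
  right_inv _ := rfl

/-- Extension of permutations of the first `r` columns by the identity. -/
def extend (n k r : ℕ) : Equiv.Perm (NV.Y n k r) →* Equiv.Perm (Sp n fun _ => k) :=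
  Equiv.Perm.extendDomainHom (columnsEquiv n k r)

lemma extend_injective (n k r : ℕ) : Function.Injective (extend n k r) :=
  Equiv.Perm.extendDomainHom_injective _

lemma extend_apply {r : ℕ} (γ : Equiv.Perm (NV.Y n k r)) (z : Fin n → NV.Cantor k) (a : Fin r) :
    extend n k r γ (z, a) = ((γ (z, a)).1, ((γ (z, a)).2 : ℕ)) :=
  Equiv.Perm.extendDomain_apply_image γ (columnsEquiv n k r) (z, a)

lemma extend_apply_of_le {r : ℕ} (γ : Equiv.Perm (NV.Y n k r)) (p : Sp n fun _ => k)
    (h : r ≤ p.2) : extend n k r γ p = p :=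
  Equiv.Perm.extendDomain_apply_not_subtype γ (columnsEquiv n k r) (not_lt.mpr h)

lemma exists_extend_eq {r : ℕ} {f : Equiv.Perm (Sp n fun _ => k)}
    (hf : f ∈ fixedBeyond (fun _ => k) r) : ∃ γ, extend n k r γ = f := by
  have hlt : ∀ p, (f p).2 < r ↔ p.2 < r := by
    intro p
    constructor
    · intro h
      by_contra hp
      rw [hf p (not_lt.mp hp)] at h
      exact hp h
    · intro h
      by_contra hp
      have := f.injective (hf (f p) (not_lt.mp hp))
      rw [this] at hp
      exact hp h
  refine ⟨(columnsEquiv n k r).symm.permCongr (f.subtypePerm hlt), ?_⟩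
  ext1 p
  by_cases hp : p.2 < r
  · exact extend_apply _ p.1 ⟨p.2, hp⟩
  · rw [extend_apply_of_le _ p (not_lt.mp hp), hf p (not_lt.mp hp)]

lemma isLevel_extend {r : ℕ} {γ : Equiv.Perm (NV.Y n k r)} (hγ : NV.IsElement γ)
    (z₀ : Fin n → NV.Cantor k) : ∃ N M, IsLevel N M (extend n k r γ) := by
  obtain ⟨m, u, v, a, b, hdom, -, hmap⟩ := hγ
  let N := ∑ t, ∑ i, (u t i).length
  let M := ∑ t, ∑ i, (v t i).length
  have hN : ∀ t i, (u t i).length ≤ N := fun t i =>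
    (Finset.single_le_sum (f := fun i => (u t i).length) (fun _ _ => Nat.zero_le _)
      (Finset.mem_univ i)).trans
      (Finset.single_le_sum (f := fun t => ∑ i, (u t i).length) (fun _ _ => Nat.zero_le _)
        (Finset.mem_univ t))
  have hM : ∀ t i, (v t i).length ≤ M := fun t i =>
    (Finset.single_le_sum (f := fun i => (v t i).length) (fun _ _ => Nat.zero_le _)
      (Finset.mem_univ i)).trans
      (Finset.single_le_sum (f := fun t => ∑ i, (v t i).length) (fun _ _ => Nat.zero_le _)
        (Finset.mem_univ t))
  refine ⟨fun _ => N, fun _ => M + N, r, r, ?_, ?_⟩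
  · intro i z
    exact extend_apply_of_le _ _ (Nat.le_add_right r i)
  · intro j hj w hw
    obtain ⟨t, ⟨x, hx⟩, -⟩ := hdom (app w z₀, ⟨j, hj⟩)
    have hx1 : ∀ i, NV.concat (u t i) (x i) = NV.concat (w i) (z₀ i) := fun i =>
      (congrFun (congrArg Prod.fst hx) i).symm
    have hx2 : (⟨j, hj⟩ : Fin r) = a t := congrArg Prod.snd hx
    choose p hp using fun i => exists_append_of_concat_eq (hx1 i) ((hN t i).trans (hw i).ge)
    refine ⟨fun i => v t i ++ p i, b t, ?_, ?_⟩
    · intro i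
      have h1 := hM t i
      have h2 := hw i
      rw [hp i] at h2
      simp only [List.length_append] at h2 ⊢
      omega
    · intro z
      have h : γ (app w z, ⟨j, hj⟩) = (app (fun i => v t i ++ p i) z, b t) := by
        rw [funext hp, hx2, ← app_app, ← app_app]
        exact hmap t (app p z)
      have h' := extend_apply γ (app w z) ⟨j, hj⟩
      rwa [h] at h'

lemma isElement_of_isUniform {r N : ℕ} {γ : Equiv.Perm (NV.Y n k r)}
    (h : IsUniform N (extend n k r γ)) (z₀ : Fin n → NV.Cantor k) : NV.IsElement γ := by
  let I := (Fin n → List.Vector (Fin k) N) × Fin r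
  let u : I → Fin n → List (Fin k) := fun t i => (t.1 i).1
  have hu : ∀ t i, (u t i).length = N := fun t i => (t.1 i).2
  have hv : ∀ t : I, ∃ (v : Fin n → List (Fin k)) (b : Fin r),
      ∀ z, γ (app (u t) z, t.2) = (app v z, b) := by
    intro t
    obtain ⟨v, b, hvb⟩ := h t.2 (u t) fun i => (hu t i).ge
    simp only [extend_apply] at hvb
    refine ⟨v, (γ (app (u t) z₀, t.2)).2, fun z => Prod.ext (Prod.mk.inj (hvb z)).1 ?_⟩
    exact Fin.ext ((Prod.mk.inj (hvb z)).2.trans (Prod.mk.inj (hvb z₀)).2.symm)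
  choose v b hvb using hv
  have hdom : ∀ y : NV.Y n k r, ∃! t : I, y ∈ NV.box (u t) t.2 := by
    rintro ⟨y, a⟩
    obtain ⟨w, x, hw, rfl⟩ := exists_app_eq N y
    refine ⟨(fun i => ⟨w i, hw i⟩, a), ⟨x, rfl⟩, ?_⟩
    rintro ⟨w', a'⟩ ⟨x', hx'⟩
    have ha : a = a' := congrArg Prod.snd hx'
    subst ha
    refine Prod.ext (funext fun i => Subtype.ext ?_) rfl
    exact (concat_inj_of_length_eq (congrFun (congrArg Prod.fst hx') i)
      ((hw i).trans (w' i).2.symm)).symm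
  have hbox : ∀ (t : I) y, γ y ∈ NV.box (v t) (b t) ↔ y ∈ NV.box (u t) t.2 := by
    intro t y
    constructor
    · rintro ⟨x, hx⟩
      exact ⟨x, γ.injective (hx.trans (hvb t x).symm)⟩
    · rintro ⟨x, rfl⟩
      exact ⟨x, hvb t x⟩
  let e := (Fintype.equivFin I).symm
  refine ⟨Fintype.card I, fun t => u (e t), fun t => v (e t), fun t => (e t).2, fun t => b (e t),
    ?_, ?_, fun t x => hvb (e t) x⟩
  · exact fun y => (e.existsUnique_congr_right (q := fun t => y ∈ NV.box (u t) t.2)).mpr (hdom y)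
  · intro y
    obtain ⟨y, rfl⟩ := γ.surjective y
    simp only [hbox]
    exact (e.existsUnique_congr_right (q := fun t => y ∈ NV.box (u t) t.2)).mpr (hdom y)

end BoxMaps

theorem statement13 (n k r : ℕ) (hn : 2 ≤ n) (hk : 2 ≤ k) (hr : 1 ≤ r)
    (G : Subgroup (Equiv.Perm (NV.Y n k r)))
    (hG : (G : Set (Equiv.Perm (NV.Y n k r))) = NV.thompsonSet n k r)
    (s : ℕ → Fin n → Equiv.Perm (WGroup.Sp n fun _ => k))
    (t : ℕ → Equiv.Perm (WGroup.Sp n fun _ => k))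
    (hs : ∀ i d p, s i d p = WGroup.sMap (fun _ => k) i d p)
    (ht : ∀ i p, t i p = WGroup.tMap (fun _ => k) i p) :
    Nonempty (↥G ≃*
      ↥(Subgroup.closure (WGroup.gens (fun _ => k) s t) ⊓
        WGroup.fixedBeyond (fun _ => k) r)) := by
  have z₀ : Fin n → NV.Cantor k := fun _ _ => ⟨0, by omega⟩
  have hmap : G.map (BoxMaps.extend n k r) =
      Subgroup.closure (WGroup.gens (fun _ => k) s t) ⊓ WGroup.fixedBeyond (fun _ => k) r := by
    have hmem : ∀ γ, γ ∈ G ↔ NV.IsElement γ := fun γ => by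
      rw [← SetLike.mem_coe, hG]
      rfl
    ext f
    constructor
    · rintro ⟨γ, hγ, rfl⟩
      refine ⟨?_, fun p hp => BoxMaps.extend_apply_of_le γ p hp⟩
      obtain ⟨N, M, hf⟩ := BoxMaps.isLevel_extend ((hmem γ).mp hγ) z₀
      refine BoxMaps.mem_of_isLevel (by omega) (fun i d => ?_) z₀ (fun i => ?_) hf
      · exact ⟨s i d, Subgroup.subset_closure (Or.inl ⟨i, d, rfl⟩), hs i d⟩
      · have h : BoxMaps.columnHom n k (Equiv.swap i (i + 1)) = t i :=
          Equiv.ext fun p => by rw [BoxMaps.columnHom_swap, ht]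
        rw [h]
        exact Subgroup.subset_closure (Or.inr ⟨i, rfl⟩)
    · rintro ⟨hf, hfix⟩
      obtain ⟨γ, rfl⟩ := BoxMaps.exists_extend_eq hfix
      obtain ⟨N, hN⟩ := BoxMaps.exists_isUniform_of_mem_closure z₀ hs ht hf
      exact ⟨γ, (hmem γ).mpr (BoxMaps.isElement_of_isUniform hN z₀), rfl⟩
  rw [← hmap]
  exact ⟨G.equivMapOfInjective _ (BoxMaps.extend_injective n k r)⟩
end

section
/- Let n ≥ 2 and k : {1,…,n} → {2,3,…}. The group W(n,k) is presented by the generators {s_{i,d}, τ_i : i ∈ ℕ, 1 ≤ d ≤ n} and the relations: (i) s_{i,d} s_{j,d'} = s_{j+k(d)−1,d'} s_{i,d} for i < j and all d, d'; (ii) τ_i² = 1; (iii) τ_i τ_j = τ_j τ_i for |i−j| ≥ 2; (iv) τ_i τ_{i+1} τ_i = τ_{i+1} τ_i τ_{i+1}; (v) s_{i,d} τ_j = τ_{j+k(d)−1} s_{i,d} for i < j; (vi) s_{i,d} τ_i = (τ_{i+k(d)−1} ⋯ τ_{i+1} τ_i) s_{i+1,d}; (vii) s_{i,d} τ_j = τ_j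 s_{i,d} for i > j+1; (viii) s_{i,d'} s_{i+1,d'} ⋯ s_{i+k(d)−1,d'} s_{i,d} = α_{i,d,d'} s_{i,d} s_{i+1,d} ⋯ s_{i+k(d')−1,d} s_{i,d'} for d ≠ d', where α_{i,d,d'} is a word in the generators {τ_m : m ∈ ℕ} whose value in W(n,k) is the homeomorphism sending (z, i + p·k(d) + q) to (z, i + q·k(d') + p) for 0 ≤ p < k(d'), 0 ≤ q < k(d), and fixing all other points. That is, the canonical surjection from the abstract group with this presentation onto W(n,k) is a group isomorphism. -/
namespace WGroup

/-- The alphabet of generators of the presentation: a generator `s_{i,d}` for each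
`(i, d)` and a generator `τ_i` for each `i`. -/
abbrev Gen (n : ℕ) : Type := (ℕ × Fin n) ⊕ ℕ

/-- The free-group letter corresponding to `s_{i,d}`. -/
def SG {n : ℕ} (i : ℕ) (d : Fin n) : FreeGroup (Gen n) := FreeGroup.of (Sum.inl (i, d))

/-- The free-group letter corresponding to `τ_i`. -/
def TG {n : ℕ} (i : ℕ) : FreeGroup (Gen n) := FreeGroup.of (Sum.inr i)

/-- The word `τ̃_{i,d} = τ_{i+k(d)-1} ⋯ τ_{i+1} τ_i` appearing in relation (vi). -/
def tauTilde {n : ℕ} (k : Fin n → ℕ) (i : ℕ) (d : Fin n) : FreeGroup (Gen n) :=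
  (((List.range (k d)).reverse).map fun m => TG (i + m)).prod

/-- The assignment of the generators to the corresponding homeomorphisms. -/
def genMap {n : ℕ} {k : Fin n → ℕ} (s : ℕ → Fin n → Equiv.Perm (Sp n k))
    (t : ℕ → Equiv.Perm (Sp n k)) : Gen n → Equiv.Perm (Sp n k) :=
  Sum.elim (fun p => s p.1 p.2) t

/-- The specified value of the permutation `α_{i,d,d'}` in relation (viii): it sends
`(z, i + p·k(d) + q)` to `(z, i + q·k(d') + p)` for `0 ≤ p < k(d')`, `0 ≤ q < k(d)`,
and fixes all other points. -/
def alphaFun {n : ℕ} (k : Fin n → ℕ) (i : ℕ) (d d' : Fin n) (p : Sp n k) : Sp n k :=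
  if i ≤ p.2 ∧ p.2 < i + k d * k d' then
    (p.1, i + ((p.2 - i) % k d) * k d' + (p.2 - i) / k d)
  else p

/-- The set of relations (i)–(viii) of the presentation of `W(n,k)`.  In relation
(viii), `α_{i,d,d'}` ranges over all words in the letters `{τ_m : m ∈ ℕ}` whose value
in `W(n,k)` is the permutation specified by `alphaFun`. -/
def rels {n : ℕ} (k : Fin n → ℕ) (s : ℕ → Fin n → Equiv.Perm (Sp n k))
    (t : ℕ → Equiv.Perm (Sp n k)) : Set (FreeGroup (Gen n)) :=
  -- (i)  s_{i,d} s_{j,d'} = s_{j+k(d)-1,d'} s_{i,d}  (i < j)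
  {w | ∃ (i j : ℕ) (d d' : Fin n), i < j ∧
    w = SG i d * SG j d' * (SG (j + (k d - 1)) d' * SG i d)⁻¹} ∪
  -- (ii)  τ_i² = 1
  {w | ∃ i : ℕ, w = TG i * TG i} ∪
  -- (iii)  τ_i τ_j = τ_j τ_i  (|i-j| ≥ 2)
  {w | ∃ i j : ℕ, (i + 2 ≤ j ∨ j + 2 ≤ i) ∧
    w = TG i * TG j * (TG j * TG i)⁻¹} ∪
  -- (iv)  τ_i τ_{i+1} τ_i = τ_{i+1} τ_i τ_{i+1}
  {w | ∃ i : ℕ, w = TG i * TG (i + 1) * TG i * (TG (i + 1) * TG i * TG (i + 1))⁻¹} ∪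
  -- (v)  s_{i,d} τ_j = τ_{j+k(d)-1} s_{i,d}  (i < j)
  {w | ∃ (i j : ℕ) (d : Fin n), i < j ∧
    w = SG i d * TG j * (TG (j + (k d - 1)) * SG i d)⁻¹} ∪
  -- (vi)  s_{i,d} τ_i = τ̃_{i,d} s_{i+1,d}
  {w | ∃ (i : ℕ) (d : Fin n), w = SG i d * TG i * (tauTilde k i d * SG (i + 1) d)⁻¹} ∪
  -- (vii)  s_{i,d} τ_j = τ_j s_{i,d}  (i > j+1)
  {w | ∃ (i j : ℕ) (d : Fin n), j + 1 < i ∧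
    w = SG i d * TG j * (TG j * SG i d)⁻¹} ∪
  -- (viii)  s_{i,d'} ⋯ s_{i+k(d)-1,d'} s_{i,d} = α_{i,d,d'} s_{i,d} ⋯ s_{i+k(d')-1,d} s_{i,d'}
  {w | ∃ (i : ℕ) (d d' : Fin n) (a : FreeGroup (Gen n)), d ≠ d' ∧
    a ∈ Subgroup.closure {g : FreeGroup (Gen n) | ∃ m : ℕ, g = TG m} ∧
    (∀ p : Sp n k, FreeGroup.lift (genMap s t) a p = alphaFun k i d d' p) ∧
    w = (((List.range (k d)).map fun m => SG (i + m) d').prod * SG i d) *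
        (a * ((List.range (k d')).map fun m => SG (i + m) d).prod * SG i d')⁻¹}

end WGroup

namespace WGroup

section Action

variable {n : ℕ} {k : Fin n → ℕ}

/-- The one-sided shift in the `d`-th coordinate. -/
def shift (d : Fin n) (z : ∀ d : Fin n, ℕ → Fin (k d)) : ∀ d : Fin n, ℕ → Fin (k d) :=
  Function.update z d (fun m => z d (m + 1))

theorem shift_same (d : Fin n) (z : ∀ d : Fin n, ℕ → Fin (k d)) (m : ℕ) :
    shift d z d m = z d (m + 1) := by
  simp [shift]

theorem shift_of_ne {d e : Fin n} (h : e ≠ d) (z : ∀ d : Fin n, ℕ → Fin (k d)) :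
    shift d z e = z e := by
  simp [shift, h]

theorem shift_comm {d e : Fin n} (h : e ≠ d) (z : ∀ d : Fin n, ℕ → Fin (k d)) :
    shift d (shift e z) = shift e (shift d z) := by
  funext f m
  by_cases h1 : f = d
  · subst h1
    rw [shift_same, shift_of_ne h.symm, shift_of_ne h.symm, shift_same]
  · by_cases h2 : f = e
    · subst h2
      rw [shift_same, shift_of_ne h, shift_of_ne h, shift_same]
    · rw [shift_of_ne h1, shift_of_ne h2, shift_of_ne h2, shift_of_ne h1]

theorem exists_shift_eq (d : Fin n) (q : Fin (k d)) (y : ∀ d : Fin n, ℕ → Fin (k d)) :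
    ∃ z, shift d z = y ∧ z d 0 = q := by
  refine ⟨Function.update y d (fun m => Nat.casesOn m q (fun m => y d m)), ?_, by simp⟩
  funext f m
  by_cases h : f = d
  · subst h
    simp [shift]
  · simp [shift, h]

theorem sMap_of_lt {i m : ℕ} (h : m < i) (d : Fin n) (z : ∀ d : Fin n, ℕ → Fin (k d)) :
    sMap k i d (z, m) = (z, m) := by
  simp [sMap, h]

theorem sMap_self (i : ℕ) (d : Fin n) (z : ∀ d : Fin n, ℕ → Fin (k d)) :
    sMap k i d (z, i) = (shift d z, i + (z d 0 : ℕ)) := by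
  simp [sMap, shift]

theorem sMap_of_gt {i m : ℕ} (h : i < m) (d : Fin n) (z : ∀ d : Fin n, ℕ → Fin (k d)) :
    sMap k i d (z, m) = (z, m + (k d - 1)) := by
  simp [sMap, h.not_gt, h.ne']

theorem tMap_eq (i m : ℕ) (z : ∀ d : Fin n, ℕ → Fin (k d)) :
    tMap k i (z, m) = (z, if m = i then i + 1 else if m = i + 1 then i else m) := by
  simp only [tMap]
  split_ifs <;> rfl

theorem tMap_swap (i m : ℕ) (z : ∀ d : Fin n, ℕ → Fin (k d)) :
    tMap k i (z, m) = (z, Equiv.swap i (i + 1) m) := by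
  rw [tMap_eq, Equiv.swap_apply_def]

variable {s : ℕ → Fin n → Equiv.Perm (Sp n k)} {t : ℕ → Equiv.Perm (Sp n k)}

theorem prod_s_apply (hk : ∀ d, 2 ≤ k d) (hs : ∀ i d p, s i d p = sMap k i d p)
    (i r : ℕ) (d : Fin n) (z : ∀ d : Fin n, ℕ → Fin (k d)) (x : ℕ) :
    ((List.range r).map fun m => s (i + m) d).prod (z, x) =
      if x < i then (z, x)
      else if x < i + r then (shift d z, i + (x - i) * k d + (z d 0 : ℕ))
      else (z, x + r * (k d - 1)) := by
  induction r generalizing z x with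
  | zero =>
    simp only [List.range_zero, List.map_nil, List.prod_nil, Equiv.Perm.one_apply]
    split_ifs <;> first | rfl | omega | simp
  | succ r ih =>
    rw [List.range_succ, List.map_append, List.prod_append]
    simp only [List.map_cons, List.map_nil, List.prod_cons, List.prod_nil, mul_one,
      Equiv.Perm.mul_apply, hs]
    have hkd := hk d
    have hz := (z d 0).isLt
    rcases lt_trichotomy x (i + r) with h | h | h
    · rw [sMap_of_lt h, ih]
      split_ifs <;> first | rfl | omega
    · subst h
      rw [sMap_self, ih]
      by_cases h0 : r = 0
      · subst h0
        simp
      · have h1 : ¬ (i + r + (z d 0 : ℕ) < i) := by omega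
        have h2 : ¬ (i + r + (z d 0 : ℕ) < i + r) := by omega
        have h3 : ¬ (i + r < i) := by omega
        have h4 : i + r < i + (r + 1) := by omega
        rw [if_neg h1, if_neg h2, if_neg h3, if_pos h4]
        obtain ⟨c, hc⟩ : ∃ c, k d = c + 1 := ⟨k d - 1, by omega⟩
        ext1
        · rfl
        · simp only [hc, Nat.add_sub_cancel, Nat.add_sub_cancel_left]
          ring
    · rw [sMap_of_gt h, ih]
      have h1 : ¬ (x + (k d - 1) < i) := by omega
      have h2 : ¬ (x + (k d - 1) < i + r) := by omega
      have h3 : ¬ (x < i) := by omega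
      have h4 : ¬ (x < i + (r + 1)) := by omega
      rw [if_neg h1, if_neg h2, if_neg h3, if_neg h4]
      ext1
      · rfl
      · simp only
        ring

theorem prod_t_apply (ht : ∀ i p, t i p = tMap k i p)
    (i r : ℕ) (z : ∀ d : Fin n, ℕ → Fin (k d)) (x : ℕ) :
    (((List.range r).reverse).map fun m => t (i + m)).prod (z, x) =
      (z, if x < i then x else if x = i then i + r else if x ≤ i + r then x - 1 else x) := by
  induction r with
  | zero =>
    simp only [List.range_zero, List.reverse_nil, List.map_nil, List.prod_nil,
      Equiv.Perm.one_apply]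
    congr 1
    grind
  | succ r ih =>
    simp only [List.range_succ, List.reverse_append, List.reverse_cons, List.reverse_nil,
      List.nil_append, List.cons_append, List.map_cons, List.prod_cons, Equiv.Perm.mul_apply]
    rw [ih, ht, tMap_eq]
    congr 1
    grind

theorem s_mul_s (hk : ∀ d, 2 ≤ k d) (hs : ∀ i d p, s i d p = sMap k i d p)
    {i j : ℕ} (hij : i < j) (d d' : Fin n) :
    s i d * s j d' = s (j + (k d - 1)) d' * s i d := by
  ext1 ⟨z, m⟩
  simp only [Equiv.Perm.mul_apply, hs]
  have := hk d
  have := (z d 0).isLt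
  rcases lt_trichotomy m i with h | h | h
  · rw [sMap_of_lt (h.trans hij), sMap_of_lt h, sMap_of_lt (by omega)]
  · subst h
    rw [sMap_of_lt hij, sMap_self, sMap_of_lt (by omega)]
  · rw [sMap_of_gt h]
    rcases lt_trichotomy m j with h' | h' | h'
    · rw [sMap_of_lt h', sMap_of_gt h, sMap_of_lt (by omega)]
    · subst h'
      rw [sMap_self, sMap_self, sMap_of_gt (by omega)]
      congr 1
      omega
    · rw [sMap_of_gt h', sMap_of_gt (by omega), sMap_of_gt (by omega)]
      congr 1
      omega

theorem t_mul_self (ht : ∀ i p, t i p = tMap k i p) (i : ℕ) : t i * t i = 1 := by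
  ext1 ⟨z, m⟩
  simp only [Equiv.Perm.mul_apply, ht, tMap_swap, Equiv.swap_apply_self, Equiv.Perm.one_apply]

theorem t_comm (ht : ∀ i p, t i p = tMap k i p) {i j : ℕ} (h : i + 2 ≤ j ∨ j + 2 ≤ i) :
    t i * t j = t j * t i := by
  ext1 ⟨z, m⟩
  simp only [Equiv.Perm.mul_apply, ht, tMap_eq]
  congr 1
  grind

theorem t_braid (ht : ∀ i p, t i p = tMap k i p) (i : ℕ) :
    t i * t (i + 1) * t i = t (i + 1) * t i * t (i + 1) := by
  ext1 ⟨z, m⟩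
  simp only [Equiv.Perm.mul_apply, ht, tMap_eq]
  congr 1
  grind

theorem s_mul_t_of_lt (hk : ∀ d, 2 ≤ k d) (hs : ∀ i d p, s i d p = sMap k i d p)
    (ht : ∀ i p, t i p = tMap k i p) {i j : ℕ} (hij : i < j) (d : Fin n) :
    s i d * t j = t (j + (k d - 1)) * s i d := by
  ext1 ⟨z, m⟩
  simp only [Equiv.Perm.mul_apply, hs, ht, tMap_eq]
  have := hk d
  have := (z d 0).isLt
  rcases lt_trichotomy m i with h | h | h
  · rw [if_neg (by omega), if_neg (by omega), sMap_of_lt h, tMap_eq]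
    congr 1
    grind
  · subst h
    rw [if_neg (by omega), if_neg (by omega), sMap_self, tMap_eq]
    congr 1
    grind
  · rw [sMap_of_gt h, sMap_of_gt (by grind), tMap_eq]
    congr 1
    grind

theorem s_mul_t_self (hs : ∀ i d p, s i d p = sMap k i d p)
    (hk : ∀ d, 2 ≤ k d) (ht : ∀ i p, t i p = tMap k i p) (i : ℕ) (d : Fin n) :
    s i d * t i = (((List.range (k d)).reverse).map fun m => t (i + m)).prod * s (i + 1) d := by
  ext1 ⟨z, m⟩
  simp only [Equiv.Perm.mul_apply, hs, ht, tMap_eq]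
  have := hk d
  have := (z d 0).isLt
  by_cases h1 : m = i
  · subst h1
    rw [if_pos rfl, sMap_of_gt (by omega), sMap_of_lt (by omega), prod_t_apply ht]
    congr 1
    grind
  by_cases h2 : m = i + 1
  · subst h2
    rw [if_neg h1, if_pos rfl, sMap_self, sMap_self, prod_t_apply ht]
    congr 1
    grind
  rw [if_neg h1, if_neg h2]
  rcases lt_or_gt_of_ne h1 with h | h
  · rw [sMap_of_lt h, sMap_of_lt (by omega), prod_t_apply ht]
    congr 1
    grind
  · rw [sMap_of_gt h, sMap_of_gt (by omega), prod_t_apply ht]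
    congr 1
    grind

theorem s_mul_t_of_gt (hs : ∀ i d p, s i d p = sMap k i d p)
    (ht : ∀ i p, t i p = tMap k i p) {i j : ℕ} (hij : j + 1 < i) (d : Fin n) :
    s i d * t j = t j * s i d := by
  ext1 ⟨z, m⟩
  simp only [Equiv.Perm.mul_apply, hs, ht, tMap_eq]
  rcases lt_trichotomy m i with h | h | h
  · rw [sMap_of_lt h, sMap_of_lt (by grind), tMap_eq]
  · subst h
    rw [if_neg (by omega), if_neg (by omega), sMap_self, tMap_eq]
    congr 1
    grind
  · rw [sMap_of_gt h, sMap_of_gt (by grind), tMap_eq]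
    congr 1
    grind

theorem alphaFun_eq (i : ℕ) (d d' : Fin n) (z : ∀ d : Fin n, ℕ → Fin (k d)) (q : Fin (k d))
    (p : Fin (k d')) :
    alphaFun k i d d' (z, i + p * k d + q) = (z, i + q * k d' + p) := by
  have hq := q.isLt
  have h : (p : ℕ) * k d + q < k d * k d' := by
    have := p.isLt
    calc (p : ℕ) * k d + q < p * k d + k d := by omega
      _ = (p + 1) * k d := by ring
      _ ≤ k d' * k d := by gcongr; omega
      _ = _ := mul_comm _ _
  have hsub : i + (p : ℕ) * k d + q - i = q + k d * p := by
    rw [Nat.mul_comm (k d)]; omega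
  rw [alphaFun, if_pos ⟨by simp only; omega, by simp only; omega⟩]
  simp only
  rw [hsub, Nat.add_mul_mod_self_left, Nat.mod_eq_of_lt hq,
    Nat.add_mul_div_left _ _ (by omega), Nat.div_eq_of_lt hq, zero_add]

theorem prod_s_mul_s (hk : ∀ d, 2 ≤ k d) (hs : ∀ i d p, s i d p = sMap k i d p)
    (i : ℕ) {d d' : Fin n} (hd : d ≠ d') (a : Equiv.Perm (Sp n k))
    (ha : ∀ p, a p = alphaFun k i d d' p) :
    ((List.range (k d)).map fun m => s (i + m) d').prod * s i d =
      a * ((List.range (k d')).map fun m => s (i + m) d).prod * s i d' := by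
  ext1 ⟨z, m⟩
  simp only [Equiv.Perm.mul_apply, hs]
  have h2 := hk d
  have h2' := hk d'
  have hz := (z d 0).isLt
  have hz' := (z d' 0).isLt
  rcases lt_trichotomy m i with h | h | h
  · rw [sMap_of_lt h, sMap_of_lt h, prod_s_apply hk hs, prod_s_apply hk hs, if_pos h, if_pos h, ha,
      alphaFun, if_neg (by simp only; omega)]
  · subst h
    rw [sMap_self, sMap_self, prod_s_apply hk hs, prod_s_apply hk hs, if_neg (by omega),
      if_pos (by omega), if_neg (by omega), if_pos (by omega), ha, shift_comm hd,
      shift_of_ne hd, shift_of_ne hd.symm, Nat.add_sub_cancel_left, Nat.add_sub_cancel_left,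
      alphaFun_eq]
  · obtain ⟨c, hc⟩ : ∃ c, k d = c + 1 := ⟨k d - 1, by omega⟩
    obtain ⟨c', hc'⟩ : ∃ c, k d' = c + 1 := ⟨k d' - 1, by omega⟩
    rw [sMap_of_gt h, sMap_of_gt h, prod_s_apply hk hs, prod_s_apply hk hs, if_neg (by omega),
      if_neg (by omega), if_neg (by omega), if_neg (by omega), ha, alphaFun, if_neg]
    · simp only [hc, hc', Nat.add_sub_cancel]
      congr 1
      ring
    · simp only [hc, hc', Nat.add_sub_cancel]
      intro hh
      have e : (c + 1) * (c' + 1) = c' + (c' + 1) * c + 1 := by ring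
      omega

/-- Every permutation of a window of copies is the value of a word in the letters `τ_m`. -/
theorem exists_word_of_perm (ht : ∀ i p, t i p = tMap k i p) (i m : ℕ)
    (π : Equiv.Perm (Fin (m + 1))) :
    ∃ a ∈ Subgroup.closure {g : FreeGroup (Gen n) | ∃ m : ℕ, g = TG m},
      (∀ z (x : Fin (m + 1)), FreeGroup.lift (genMap s t) a (z, i + x) = (z, i + π x)) ∧
      ∀ z x, (x < i ∨ i + m < x) → FreeGroup.lift (genMap s t) a (z, x) = (z, x) := by
  have hπ : π ∈ Submonoid.closure
      (Set.range fun j : Fin m => Equiv.swap j.castSucc j.succ) := by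
    rw [Equiv.Perm.mclosure_swap_castSucc_succ]
    trivial
  induction hπ using Submonoid.closure_induction with
  | one => exact ⟨1, one_mem _, by simp, by simp⟩
  | mem x hx =>
    obtain ⟨j, rfl⟩ := hx
    refine ⟨TG (i + j), Subgroup.subset_closure ⟨_, rfl⟩, ?_, ?_⟩
    · intro z x
      simp only [TG, FreeGroup.lift_apply_of, genMap, Sum.elim_inr, ht, tMap_eq,
        Equiv.swap_apply_def, Fin.ext_iff]
      congr 1
      grind
    · intro z x hx
      simp only [TG, FreeGroup.lift_apply_of, genMap, Sum.elim_inr, ht, tMap_eq]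
      congr 1
      have := j.isLt
      grind
  | mul x y _ _ hx hy =>
    obtain ⟨a, ha, ha1, ha2⟩ := hx
    obtain ⟨b, hb, hb1, hb2⟩ := hy
    refine ⟨a * b, mul_mem ha hb, ?_, ?_⟩
    · intro z x
      rw [map_mul, Equiv.Perm.mul_apply, hb1, ha1]
      rfl
    · intro z x h
      rw [map_mul, Equiv.Perm.mul_apply, hb2 _ _ h, ha2 _ _ h]

theorem exists_alpha (hk : ∀ d, 2 ≤ k d) (ht : ∀ i p, t i p = tMap k i p) (i : ℕ)
    (d d' : Fin n) :
    ∃ a ∈ Subgroup.closure {g : FreeGroup (Gen n) | ∃ m : ℕ, g = TG m},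
      ∀ p, FreeGroup.lift (genMap s t) a p = alphaFun k i d d' p := by
  have hpos : 0 < k d * k d' := Nat.mul_pos (by have := hk d; omega) (by have := hk d'; omega)
  obtain ⟨m, hm⟩ : ∃ m, k d * k d' = m + 1 := ⟨k d * k d' - 1, by omega⟩
  have hm' : k d' * k d = m + 1 := by rw [mul_comm, hm]
  let e : Fin (k d') × Fin (k d) ≃ Fin (m + 1) := finProdFinEquiv.trans (finCongr hm')
  let e' : Fin (k d) × Fin (k d') ≃ Fin (m + 1) := finProdFinEquiv.trans (finCongr hm)
  obtain ⟨a, ha, h1, h2⟩ := exists_word_of_perm (s := s) ht i m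
    ((e.symm.trans (Equiv.prodComm _ _)).trans e')
  refine ⟨a, ha, ?_⟩
  rintro ⟨z, x⟩
  by_cases hx : i ≤ x ∧ x < i + k d * k d'
  · obtain ⟨y, rfl⟩ : ∃ y : Fin (m + 1), x = i + y := ⟨⟨x - i, by omega⟩, by simp only; omega⟩
    obtain ⟨⟨p, q⟩, rfl⟩ := e.surjective y
    have h3 : ((e (p, q) : Fin (m + 1)) : ℕ) = p * k d + q := by
      simp [e, finProdFinEquiv]; ring
    have h4 : ((e' (q, p) : Fin (m + 1)) : ℕ) = q * k d' + p := by
      simp [e', finProdFinEquiv]; ring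
    rw [h1, h3, ← add_assoc, alphaFun_eq]
    simp [h4, add_assoc]
  · rw [h2 _ _ (by omega), alphaFun, if_neg hx]

end Action

/-- A group generated by elements subject to the relations of the presentation, together with a
homomorphism to the permutations of `Z × ℕ` extending the defining action of the generators. -/
structure Model {n : ℕ} (k : Fin n → ℕ) (G : Type*) [Group G] where
  S : ℕ → Fin n → G
  T : ℕ → G
  φ : G →* Equiv.Perm (Sp n k)
  two_le : ∀ d, 2 ≤ k d
  φ_S : ∀ i d p, φ (S i d) p = sMap k i d p
  φ_T : ∀ i p, φ (T i) p = tMap k i p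
  closure_eq : Subgroup.closure {g | (∃ i d, g = S i d) ∨ ∃ i, g = T i} = ⊤
  S_mul_S : ∀ {i j}, i < j → ∀ d d', S i d * S j d' = S (j + (k d - 1)) d' * S i d
  T_mul_self : ∀ i, T i * T i = 1
  T_comm : ∀ {i j}, i + 2 ≤ j → T i * T j = T j * T i
  T_braid : ∀ i, T i * T (i + 1) * T i = T (i + 1) * T i * T (i + 1)
  S_mul_T_of_lt : ∀ {i j}, i < j → ∀ d, S i d * T j = T (j + (k d - 1)) * S i d
  S_mul_T_self : ∀ i d, S i d * T i =
    (((List.range (k d)).reverse).map fun m => T (i + m)).prod * S (i + 1) d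
  S_mul_T_of_gt : ∀ {i j}, j + 1 < i → ∀ d, S i d * T j = T j * S i d
  prod_S_mul_S : ∀ i {d d'}, d ≠ d' → ∃ a ∈ Subgroup.closure {g | ∃ m, g = T m},
    ((List.range (k d)).map fun m => S (i + m) d').prod * S i d =
      a * (((List.range (k d')).map fun m => S (i + m) d).prod * S i d')

namespace Model

variable {n : ℕ} {k : Fin n → ℕ} {G : Type*} [Group G] (W : Model k G)

/-- The positive monoid, generated by all `s_{i,d}` and `τ_i`. -/
def M : Submonoid G := Submonoid.closure {g | (∃ i d, g = W.S i d) ∨ ∃ i, g = W.T i}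

theorem S_mem (i : ℕ) (d : Fin n) : W.S i d ∈ W.M :=
  Submonoid.subset_closure (Or.inl ⟨i, d, rfl⟩)

theorem T_mem (i : ℕ) : W.T i ∈ W.M :=
  Submonoid.subset_closure (Or.inr ⟨i, rfl⟩)

theorem T_inv (i : ℕ) : (W.T i)⁻¹ = W.T i :=
  inv_eq_of_mul_eq_one_left (W.T_mul_self i)

theorem mem_of_mem_closure_T {a : G} (ha : a ∈ Subgroup.closure {g | ∃ m, g = W.T m}) :
    a ∈ W.M := by
  induction ha using Subgroup.closure_induction_right with
  | one => exact one_mem _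
  | mul_right x _ y hy ih =>
    obtain ⟨m, rfl⟩ := hy
    exact mul_mem ih (W.T_mem m)
  | mul_inv_cancel x _ y hy ih =>
    obtain ⟨m, rfl⟩ := hy
    rw [T_inv]
    exact mul_mem ih (W.T_mem m)

theorem M_induction {p : (x : G) → x ∈ W.M → Prop} (one : p 1 (one_mem _))
    (mul_S : ∀ x (hx : x ∈ W.M), p x hx → ∀ i d, p (x * W.S i d) (mul_mem hx (W.S_mem i d)))
    (mul_T : ∀ x (hx : x ∈ W.M), p x hx → ∀ i, p (x * W.T i) (mul_mem hx (W.T_mem i)))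
    {x : G} (hx : x ∈ W.M) : p x hx := by
  induction hx using Submonoid.closure_induction_right with
  | one => exact one
  | mul_right x hx y hy ih =>
    rcases hy with ⟨i, d, rfl⟩ | ⟨i, rfl⟩
    · exact mul_S x hx ih i d
    · exact mul_T x hx ih i

theorem φ_T_apply (i m : ℕ) (z : ∀ d : Fin n, ℕ → Fin (k d)) :
    W.φ (W.T i) (z, m) = (z, Equiv.swap i (i + 1) m) := by
  rw [W.φ_T, tMap_swap]

/-! ### Divisibility on the right -/

theorem exists_S_mul_T (i j : ℕ) (d : Fin n) :
    ∃ a ∈ W.M, W.S (Equiv.swap j (j + 1) i) d * W.T j = a * W.S i d := by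
  have hmem : ∀ i d, (((List.range (k d)).reverse).map fun m => W.T (i + m)).prod ∈
      Subgroup.closure {g | ∃ m, g = W.T m} := by
    intro i d
    refine list_prod_mem ?_
    intro x hx
    obtain ⟨m, -, rfl⟩ := List.mem_map.1 hx
    exact Subgroup.subset_closure ⟨_, rfl⟩
  by_cases h1 : i = j
  · subst h1
    refine ⟨_, W.mem_of_mem_closure_T (inv_mem (hmem i d)), ?_⟩
    rw [Equiv.swap_apply_left, eq_inv_mul_iff_mul_eq, ← mul_assoc, ← W.S_mul_T_self, mul_assoc,
      W.T_mul_self, mul_one]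
  by_cases h2 : i = j + 1
  · subst h2
    refine ⟨_, W.mem_of_mem_closure_T (hmem j d), ?_⟩
    rw [Equiv.swap_apply_right, W.S_mul_T_self]
  rw [Equiv.swap_apply_of_ne_of_ne h1 h2]
  rcases lt_or_gt_of_ne h1 with h | h
  · exact ⟨_, W.T_mem _, W.S_mul_T_of_lt h d⟩
  · exact ⟨_, W.T_mem _, W.S_mul_T_of_gt (by omega) d⟩

/-- The index reached from copy `i` by `s_{j,d}`, for `i ≠ j`. -/
def pushIndex (k : Fin n → ℕ) (j : ℕ) (d : Fin n) (i : ℕ) : ℕ :=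
  if i < j then i else i + (k d - 1)

theorem sMap_pushIndex {i j : ℕ} (h : i ≠ j) (d : Fin n) (z : ∀ d : Fin n, ℕ → Fin (k d)) :
    sMap k j d (z, i) = (z, pushIndex k j d i) := by
  rcases lt_or_gt_of_ne h with h | h
  · rw [sMap_of_lt h, pushIndex, if_pos h]
  · rw [sMap_of_gt h, pushIndex, if_neg h.not_gt]

theorem exists_S_mul_S {i j : ℕ} (h : i ≠ j) (d d' : Fin n) :
    ∃ a ∈ W.M, W.S (pushIndex k j d' i) d * W.S j d' = a * W.S i d := by
  rcases lt_or_gt_of_ne h with h | h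
  · exact ⟨_, W.S_mem _ _, by rw [pushIndex, if_pos h, W.S_mul_S h]⟩
  · exact ⟨_, W.S_mem _ _, by rw [pushIndex, if_neg h.not_gt, ← W.S_mul_S h]⟩

/-- `R` separates copy `i` according to the first letter of the `d`-th coordinate. -/
def Separates (R : G) (i : ℕ) (d : Fin n) : Prop :=
  ∀ z z', (W.φ R (z, i)).2 = (W.φ R (z', i)).2 → z d 0 = z' d 0

theorem Separates.of_mul_of_apply {R x : G} {i j : ℕ} {d : Fin n}
    (h : W.Separates (R * x) i d) (hx : ∀ z, W.φ x (z, i) = (z, j)) : W.Separates R j d := by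
  intro z z' hz
  apply h
  rw [map_mul, Equiv.Perm.mul_apply, Equiv.Perm.mul_apply, hx, hx, hz]

/-- `R` acts as translation by `m` on all copies of sufficiently large index. -/
def Translates (R : G) (m : ℕ) : Prop :=
  ∃ L, ∀ p : Sp n k, L ≤ p.2 → (W.φ R p).2 = p.2 + m

theorem Translates.unique {R : G} {m m' : ℕ} (h : W.Translates R m) (h' : W.Translates R m') :
    m = m' := by
  obtain ⟨L, hL⟩ := h
  obtain ⟨L', hL'⟩ := h'
  have h1 := hL (fun d => fun _ => ⟨0, by have := W.two_le d; omega⟩, max L L') (le_max_left _ _)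
  have h2 := hL' (fun d => fun _ => ⟨0, by have := W.two_le d; omega⟩, max L L') (le_max_right _ _)
  omega

theorem Translates.mul_S {R : G} {m : ℕ} (h : W.Translates R m) (i : ℕ) (d : Fin n) :
    W.Translates (R * W.S i d) (m + (k d - 1)) := by
  obtain ⟨L, hL⟩ := h
  refine ⟨max L (i + 1), ?_⟩
  rintro ⟨z, x⟩ hx
  have h1 := le_trans (le_max_left _ _) hx
  have h2 := le_trans (le_max_right _ _) hx
  simp only at h1 h2
  rw [map_mul, Equiv.Perm.mul_apply, W.φ_S, sMap_of_gt (by omega), hL _ (by simp only; omega)]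
  simp only
  omega

theorem Translates.mul_T {R : G} {m : ℕ} (h : W.Translates R m) (i : ℕ) :
    W.Translates (R * W.T i) m := by
  obtain ⟨L, hL⟩ := h
  refine ⟨max L (i + 2), ?_⟩
  rintro ⟨z, x⟩ hx
  have h1 := le_trans (le_max_left _ _) hx
  have h2 := le_trans (le_max_right _ _) hx
  simp only at h1 h2
  rw [map_mul, Equiv.Perm.mul_apply, W.φ_T_apply,
    Equiv.swap_apply_of_ne_of_ne (by omega) (by omega), hL _ h1]

theorem exists_translates {R : G} (hR : R ∈ W.M) : ∃ m, W.Translates R m := by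
  induction hR using W.M_induction with
  | one => exact ⟨0, 0, by simp⟩
  | mul_S x _ ih i d => exact ⟨_, Translates.mul_S W ih.choose_spec i d⟩
  | mul_T x _ ih i => exact ⟨_, Translates.mul_T W ih.choose_spec i⟩

theorem Translates.of_mul_S {R : G} (hR : R ∈ W.M) {m i : ℕ} {d : Fin n}
    (h : W.Translates (R * W.S i d) m) :
    ∃ m' < m, W.Translates R m' := by
  obtain ⟨m', hm'⟩ := W.exists_translates hR
  have := Translates.unique W h (Translates.mul_S W hm' i d)
  have := W.two_le d
  exact ⟨m', by omega, hm'⟩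

theorem exists_eq_mul_prod {m : ℕ} {d : Fin n}
    (ih : ∀ m' < m, ∀ {R : G}, R ∈ W.M → W.Translates R m' → ∀ i, W.Separates R i d →
      ∃ A ∈ W.M, R = A * W.S i d) (i r : ℕ) :
    ∀ {R : G}, R ∈ W.M → ∀ {m'}, m' < m → W.Translates R m' →
      (∀ q < r, W.Separates R (i + q) d) →
      ∃ A ∈ W.M, R = A * ((List.range r).map fun m => W.S (i + m) d).prod := by
  induction r with
  | zero => exact fun {R} hR _ _ _ _ => ⟨R, hR, by simp⟩
  | succ r ihr =>
    intro R hR m' hm' htr hsep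
    obtain ⟨A, hA, rfl⟩ := ih m' hm' hR htr (i + r) (hsep r (Nat.lt_succ_self r))
    obtain ⟨m'', hm'', htr'⟩ := Translates.of_mul_S W hA htr
    obtain ⟨B, hB, rfl⟩ := ihr hA (hm''.trans hm') htr' fun q hq =>
      Separates.of_mul_of_apply W (hsep q (by omega)) fun z => by
        rw [W.φ_S, sMap_of_lt (by omega)]
    refine ⟨B, hB, ?_⟩
    rw [List.range_succ, List.map_append, List.prod_append]
    simp [mul_assoc]

/-- An element of the positive monoid that separates copy `i` in direction `d` is right
divisible by `s_{i,d}`. -/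
theorem exists_eq_mul_S (m : ℕ) (d : Fin n) {R : G} (hR : R ∈ W.M) (htr : W.Translates R m)
    (i : ℕ) (hsep : W.Separates R i d) : ∃ A ∈ W.M, R = A * W.S i d := by
  induction m using Nat.strong_induction_on generalizing R i with
  | _ m ih =>
  replace ih : ∀ m' < m, ∀ {R : G}, R ∈ W.M → W.Translates R m' → ∀ i, W.Separates R i d →
      ∃ A ∈ W.M, R = A * W.S i d := fun m' hm' _ hR htr i hsep => ih m' hm' hR htr i hsep
  induction hR using W.M_induction generalizing i with
  | one =>
    exfalso
    have h2 := W.two_le d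
    have h := hsep (fun d => fun _ => ⟨0, by have := W.two_le d; omega⟩)
      (fun d => fun _ => ⟨1, by have := W.two_le d; omega⟩) (by simp)
    simp [Fin.ext_iff] at h
  | mul_T x hx ihx j =>
    have htr' : W.Translates x m := by
      have := Translates.mul_T W htr j
      rwa [mul_assoc, W.T_mul_self, mul_one] at this
    obtain ⟨A, hA, rfl⟩ := ihx htr' _
      (Separates.of_mul_of_apply W hsep fun z => W.φ_T_apply j i z)
    obtain ⟨B, hB, h⟩ := W.exists_S_mul_T i j d
    exact ⟨A * B, mul_mem hA hB, by rw [mul_assoc, h, mul_assoc]⟩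
  | mul_S x hx ihx j d' =>
    obtain ⟨m', hm', htr'⟩ := Translates.of_mul_S W hx htr
    by_cases hij : i = j
    · subst hij
      by_cases hd : d = d'
      · subst hd
        exact ⟨x, hx, rfl⟩
      have hsep' : ∀ q < k d', W.Separates x (i + q) d := by
        intro q hq y y' hy
        obtain ⟨z, rfl, hz⟩ := exists_shift_eq d' ⟨q, hq⟩ y
        obtain ⟨z', rfl, hz'⟩ := exists_shift_eq d' ⟨q, hq⟩ y'
        rw [shift_of_ne hd, shift_of_ne hd]
        apply hsep
        rw [map_mul, Equiv.Perm.mul_apply, Equiv.Perm.mul_apply, W.φ_S, W.φ_S, sMap_self,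
          sMap_self, hz, hz', hy]
      obtain ⟨A, hA, rfl⟩ := W.exists_eq_mul_prod ih i (k d') hx hm' htr' hsep'
      obtain ⟨a, ha, h⟩ := W.prod_S_mul_S i hd
      refine ⟨A * (a⁻¹ * ((List.range (k d)).map fun m => W.S (i + m) d').prod), ?_, ?_⟩
      · refine mul_mem hA (mul_mem (W.mem_of_mem_closure_T (inv_mem ha)) (list_prod_mem ?_))
        intro x hx
        obtain ⟨m, -, rfl⟩ := List.mem_map.1 hx
        exact W.S_mem _ _
      · rw [mul_assoc, mul_assoc, mul_assoc, h, inv_mul_cancel_left]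
    · obtain ⟨A, hA, rfl⟩ := ih m' hm' hx htr' _
        (Separates.of_mul_of_apply W hsep fun z => by rw [W.φ_S, sMap_pushIndex hij])
      obtain ⟨B, hB, h⟩ := W.exists_S_mul_S hij d d'
      exact ⟨A * B, mul_mem hA hB, by rw [mul_assoc, h, mul_assoc]⟩

/-! ### Common left multiples -/

theorem S_keeps_apart (i : ℕ) (e : Fin n) (p p' : Sp n k)
    (h : (W.φ (W.S i e) p).2 = (W.φ (W.S i e) p').2) :
    p.2 = p'.2 ∧ (p.2 = i → p.1 e 0 = p'.1 e 0) := by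
  obtain ⟨z, x⟩ := p
  obtain ⟨z', x'⟩ := p'
  rw [W.φ_S, W.φ_S] at h
  have h1 := (z e 0).isLt
  have h2 := (z' e 0).isLt
  simp only [Fin.ext_iff]
  simp only [sMap] at h
  split_ifs at h <;> simp only at h <;> omega

theorem keeps_apart {R : G} (hR : R ∈ W.M) (p p' : Sp n k)
    (h : (W.φ R p).2 = (W.φ R p').2) : p.2 = p'.2 := by
  induction hR using W.M_induction generalizing p p' with
  | one => simpa using h
  | mul_S x _ ih i d =>
    rw [map_mul, Equiv.Perm.mul_apply, Equiv.Perm.mul_apply] at h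
    exact (W.S_keeps_apart i d p p' (ih _ _ h)).1
  | mul_T x _ ih i =>
    rw [map_mul, Equiv.Perm.mul_apply, Equiv.Perm.mul_apply] at h
    have := ih _ _ h
    rwa [W.φ_T_apply, W.φ_T_apply, EmbeddingLike.apply_eq_iff_eq] at this

theorem separates_mul_S {R : G} (hR : R ∈ W.M) (i : ℕ) (d : Fin n) :
    W.Separates (R * W.S i d) i d := by
  intro z z' h
  rw [map_mul, Equiv.Perm.mul_apply, Equiv.Perm.mul_apply] at h
  exact (W.S_keeps_apart i d _ _ (W.keeps_apart hR _ _ h)).2 rfl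

/-- The first letter of the `d`-th coordinate of a point is determined by the index of the copy
containing its image together with the first letter of the `d`-th coordinate of the image. -/
theorem letter_eq {R : G} (hR : R ∈ W.M) (d : Fin n) (p p' : Sp n k)
    (h : (W.φ R p).2 = (W.φ R p').2) (hd : (W.φ R p).1 d 0 = (W.φ R p').1 d 0) :
    p.1 d 0 = p'.1 d 0 := by
  induction hR using W.M_induction generalizing p p' with
  | one => simpa using hd
  | mul_S x hx ih i e =>
    rw [map_mul, Equiv.Perm.mul_apply, Equiv.Perm.mul_apply] at h hd
    have h1 := ih _ _ h hd
    obtain ⟨h2, h3⟩ := W.S_keeps_apart i e p p' (W.keeps_apart hx _ _ h)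
    obtain ⟨z, m⟩ := p
    obtain ⟨z', m'⟩ := p'
    obtain rfl : m = m' := h2
    rw [W.φ_S, W.φ_S] at h1
    by_cases hm : m = i
    · subst hm
      by_cases he : d = e
      · subst he
        exact h3 rfl
      · simpa only [sMap_self, shift_of_ne he] using h1
    · rwa [sMap_pushIndex hm, sMap_pushIndex hm] at h1
  | mul_T x _ ih i =>
    rw [map_mul, Equiv.Perm.mul_apply, Equiv.Perm.mul_apply] at h hd
    have := ih _ _ h hd
    rwa [W.φ_T, W.φ_T, tMap_swap, tMap_swap] at this

theorem exists_apply_le {R : G} (hR : R ∈ W.M) : ∃ c, ∀ p, (W.φ R p).2 ≤ p.2 + c := by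
  induction hR using W.M_induction with
  | one => exact ⟨0, by simp⟩
  | mul_S x _ ih i d =>
    obtain ⟨c, hc⟩ := ih
    refine ⟨c + k d, ?_⟩
    rintro ⟨z, m⟩
    rw [map_mul, Equiv.Perm.mul_apply]
    refine (hc _).trans ?_
    have := (z d 0).isLt
    rw [W.φ_S]
    rcases lt_trichotomy m i with h | rfl | h
    · rw [sMap_of_lt h]; simp only; omega
    · rw [sMap_self]; simp only; omega
    · rw [sMap_of_gt h]; simp only; omega
  | mul_T x _ ih i =>
    obtain ⟨c, hc⟩ := ih
    refine ⟨c + 1, ?_⟩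
    rintro ⟨z, m⟩
    rw [map_mul, Equiv.Perm.mul_apply]
    refine (hc _).trans ?_
    rw [W.φ_T, tMap_eq]
    simp only
    split_ifs <;> omega

theorem exists_letter_eq (d : Fin n) (L : ℕ) : ∃ A ∈ W.M, ∀ p p' : Sp n k, p.2 < L →
    (W.φ A p).2 = (W.φ A p').2 → p.1 d 0 = p'.1 d 0 := by
  induction L with
  | zero => exact ⟨1, one_mem _, by simp⟩
  | succ L ih =>
    obtain ⟨A, hA, h⟩ := ih
    refine ⟨A * W.S L d, mul_mem hA (W.S_mem _ _), ?_⟩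
    rintro ⟨z, m⟩ ⟨z', m'⟩ hm he
    obtain rfl : m = m' := W.keeps_apart (mul_mem hA (W.S_mem L d)) _ _ he
    by_cases hmL : m = L
    · subst hmL
      exact W.separates_mul_S hA _ _ z z' he
    · have hlt : m < L := by simp only at hm; omega
      rw [map_mul, Equiv.Perm.mul_apply, Equiv.Perm.mul_apply, W.φ_S, W.φ_S, sMap_of_lt hlt,
        sMap_of_lt hlt] at he
      exact h _ _ hlt he

theorem exists_mul_eq_mul_S {R : G} (hR : R ∈ W.M) (i : ℕ) (d : Fin n) :
    ∃ A ∈ W.M, ∃ B ∈ W.M, A * R = B * W.S i d := by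
  obtain ⟨c, hc⟩ := W.exists_apply_le hR
  obtain ⟨A, hA, h⟩ := W.exists_letter_eq d (i + c + 1)
  refine ⟨A, hA, ?_⟩
  obtain ⟨m, hm⟩ := W.exists_translates (mul_mem hA hR)
  refine W.exists_eq_mul_S m d (mul_mem hA hR) hm i ?_
  intro z z' he
  rw [map_mul, Equiv.Perm.mul_apply, Equiv.Perm.mul_apply] at he
  refine W.letter_eq hR d (z, i) (z', i) (W.keeps_apart hA _ _ he) (h _ _ ?_ he)
  have := hc (z, i)
  simp only at this
  omega

theorem exists_eq_inv_mul (g : G) : ∃ P ∈ W.M, ∃ Q ∈ W.M, g = P⁻¹ * Q := by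
  have hg : g ∈ Subgroup.closure {g | (∃ i d, g = W.S i d) ∨ ∃ i, g = W.T i} := by
    rw [W.closure_eq]
    trivial
  induction hg using Subgroup.closure_induction_right with
  | one => exact ⟨1, one_mem _, 1, one_mem _, by simp⟩
  | mul_right x _ y hy ih =>
    obtain ⟨P, hP, Q, hQ, rfl⟩ := ih
    exact ⟨P, hP, Q * y, mul_mem hQ (Submonoid.subset_closure hy), mul_assoc _ _ _⟩
  | mul_inv_cancel x _ y hy ih =>
    obtain ⟨P, hP, Q, hQ, rfl⟩ := ih
    rcases hy with ⟨i, d, rfl⟩ | ⟨i, rfl⟩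
    · obtain ⟨A, hA, B, hB, h⟩ := W.exists_mul_eq_mul_S hQ i d
      refine ⟨A * P, mul_mem hA hP, B, hB, ?_⟩
      rw [eq_mul_inv_of_mul_eq h.symm]
      group
    · exact ⟨P, hP, Q * W.T i, mul_mem hQ (W.T_mem i), by rw [T_inv, mul_assoc]⟩

/-! ### Faithfulness of the finitary symmetric group -/

/-- The subgroup generated by `τ_0, …, τ_{m-1}`. -/
def Sym (m : ℕ) : Subgroup G := Subgroup.closure {g | ∃ i < m, g = W.T i}

/-- The word `τ_{j+r-1} ⋯ τ_{j+1} τ_j`. -/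
def cyc (j r : ℕ) : G := (((List.range r).reverse).map fun m => W.T (j + m)).prod

theorem cyc_succ (j r : ℕ) : W.cyc j (r + 1) = W.T (j + r) * W.cyc j r := by
  simp [cyc, List.range_succ]

theorem cyc_zero (j : ℕ) : W.cyc j 0 = 1 := by
  simp [cyc]

theorem cyc_mul_T_pred (j r : ℕ) : W.cyc (j + 1) r * W.T j = W.cyc j (r + 1) := by
  induction r with
  | zero => simp [cyc_succ, cyc_zero]
  | succ r ih => rw [cyc_succ, mul_assoc, ih, W.cyc_succ j (r + 1), add_right_comm, add_assoc]

theorem cyc_mul_T_of_lt {i j : ℕ} (h : i + 2 ≤ j) (r : ℕ) :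
    W.cyc j r * W.T i = W.T i * W.cyc j r := by
  induction r with
  | zero => simp [cyc_zero]
  | succ r ih =>
    rw [cyc_succ, mul_assoc, ih, ← mul_assoc, ← mul_assoc, W.T_comm (by omega : i + 2 ≤ j + r)]

theorem cyc_comm_T {i j r : ℕ} (h : j + r + 1 ≤ i) :
    W.cyc j r * W.T i = W.T i * W.cyc j r := by
  induction r with
  | zero => simp [cyc_zero]
  | succ r ih =>
    rw [cyc_succ, mul_assoc, ih (by omega), ← mul_assoc, ← mul_assoc,
      W.T_comm (by omega : j + r + 2 ≤ i)]

theorem cyc_mul_T_of_gt {j q r : ℕ} (h : q + 2 ≤ r) :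
    W.cyc j r * W.T (j + q + 1) = W.T (j + q) * W.cyc j r := by
  induction r, h using Nat.le_induction with
  | base =>
    rw [cyc_succ, cyc_succ, mul_assoc, mul_assoc, W.cyc_comm_T (by omega), ← mul_assoc,
      ← mul_assoc, ← add_assoc, ← W.T_braid, mul_assoc, mul_assoc]
  | succ r hr ih =>
    rw [cyc_succ, mul_assoc, ih, ← mul_assoc, ← mul_assoc,
      W.T_comm (by omega : j + q + 2 ≤ j + r)]

theorem exists_eq_mul_cyc {m : ℕ} {g : G} (hg : g ∈ W.Sym (m + 1)) :
    ∃ j r, j + r = m + 1 ∧ ∃ h ∈ W.Sym m, g = h * W.cyc j r := by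
  have key : ∀ x y, (∃ i < m + 1, y = W.T i) →
      (∃ j r, j + r = m + 1 ∧ ∃ h ∈ W.Sym m, x = h * W.cyc j r) →
      ∃ j r, j + r = m + 1 ∧ ∃ h ∈ W.Sym m, x * y = h * W.cyc j r := by
    rintro _ _ ⟨i, hi, rfl⟩ ⟨j, r, hjr, h, hh, rfl⟩
    rcases lt_trichotomy i j with hij | rfl | hij
    · obtain rfl | hij := Nat.eq_or_lt_of_le hij
      · exact ⟨i, r + 1, by omega, h, hh, by rw [mul_assoc]; congr 1; exact W.cyc_mul_T_pred i r⟩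
      · refine ⟨j, r, hjr, h * W.T i,
          mul_mem hh (Subgroup.subset_closure ⟨i, by omega, rfl⟩), ?_⟩
        rw [mul_assoc, W.cyc_mul_T_of_lt hij, mul_assoc]
    · obtain ⟨r, rfl⟩ : ∃ r', r = r' + 1 := ⟨r - 1, by omega⟩
      refine ⟨i + 1, r, by omega, h, hh, ?_⟩
      rw [← cyc_mul_T_pred, mul_assoc, mul_assoc, W.T_mul_self, mul_one]
    · obtain ⟨q, rfl⟩ : ∃ q, i = j + q + 1 := ⟨i - j - 1, by omega⟩
      refine ⟨j, r, hjr, h * W.T (j + q),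
        mul_mem hh (Subgroup.subset_closure ⟨_, by omega, rfl⟩), ?_⟩
      rw [mul_assoc, W.cyc_mul_T_of_gt (by omega), mul_assoc]
  induction hg using Subgroup.closure_induction_right with
  | one => exact ⟨m + 1, 0, rfl, 1, one_mem _, by simp [cyc_zero]⟩
  | mul_right x _ y hy ih => exact key x y hy ih
  | mul_inv_cancel x _ y hy ih =>
    have h := key x y hy ih
    obtain ⟨i, -, rfl⟩ := hy
    rwa [T_inv]

theorem φ_cyc_apply (j r : ℕ) (z : ∀ d : Fin n, ℕ → Fin (k d)) :
    W.φ (W.cyc j r) (z, j) = (z, j + r) := by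
  induction r with
  | zero => simp [cyc_zero]
  | succ r ih =>
    rw [cyc_succ, map_mul, Equiv.Perm.mul_apply, ih, W.φ_T_apply, Equiv.swap_apply_left, add_assoc]

theorem φ_apply_of_mem_Sym {m : ℕ} {g : G} (hg : g ∈ W.Sym m) {x : ℕ} (hx : m < x)
    (z : ∀ d : Fin n, ℕ → Fin (k d)) : W.φ g (z, x) = (z, x) := by
  induction hg using Subgroup.closure_induction with
  | one => simp
  | mem y hy =>
    obtain ⟨i, hi, rfl⟩ := hy
    rw [W.φ_T_apply, Equiv.swap_apply_of_ne_of_ne (by omega) (by omega)]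
  | mul a b _ _ ha hb => rw [map_mul, Equiv.Perm.mul_apply, hb, ha]
  | inv a _ ha => rw [map_inv, Equiv.Perm.inv_eq_iff_eq, ha]

theorem eq_one_of_mem_Sym {m : ℕ} {g : G} (hg : g ∈ W.Sym m) (h : W.φ g = 1) : g = 1 := by
  induction m generalizing g with
  | zero => simpa [Sym] using hg
  | succ m ih =>
    obtain ⟨j, r, hjr, a, ha, rfl⟩ := W.exists_eq_mul_cyc hg
    have hz := DFunLike.congr_fun h
      ((fun d => fun _ => ⟨0, by have := W.two_le d; omega⟩ : ∀ d : Fin n, ℕ → Fin (k d)), j)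
    rw [map_mul, Equiv.Perm.mul_apply, W.φ_cyc_apply, hjr,
      W.φ_apply_of_mem_Sym ha (Nat.lt_succ_self m), Equiv.Perm.one_apply, Prod.mk.injEq] at hz
    obtain rfl : r = 0 := by omega
    rw [cyc_zero, mul_one] at h ⊢
    exact ih ha h

/-! ### Faithfulness of the model -/

theorem Sym_mono {m m' : ℕ} (h : m ≤ m') : W.Sym m ≤ W.Sym m' :=
  Subgroup.closure_mono fun _ ⟨i, hi, e⟩ => ⟨i, hi.trans_le h, e⟩

theorem exists_mem_Sym {R : G} (hR : R ∈ W.M) (h : W.Translates R 0) : ∃ m, R ∈ W.Sym m := by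
  induction hR using W.M_induction with
  | one => exact ⟨0, one_mem _⟩
  | mul_S x hx _ i d =>
    obtain ⟨m', hm', -⟩ := Translates.of_mul_S W hx h
    omega
  | mul_T x hx ih i =>
    obtain ⟨m, hm⟩ := ih (by
      have := Translates.mul_T W h i
      rwa [mul_assoc, W.T_mul_self, mul_one] at this)
    exact ⟨max m (i + 1), mul_mem (W.Sym_mono (le_max_left _ _) hm)
      (Subgroup.subset_closure ⟨i, by omega, rfl⟩)⟩

theorem eq_of_φ_eq {R R' : G} (hR : R ∈ W.M) (hR' : R' ∈ W.M) (h : W.φ R = W.φ R') :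
    R = R' := by
  induction hR using W.M_induction generalizing R' with
  | one =>
    rw [map_one] at h
    obtain ⟨m, hm⟩ := W.exists_mem_Sym hR' ⟨0, by simp [← h]⟩
    exact (W.eq_one_of_mem_Sym hm h.symm).symm
  | mul_S x hx ih i d =>
    obtain ⟨m, hm⟩ := W.exists_translates hR'
    have hsep : W.Separates R' i d := by
      have := W.separates_mul_S hx i d
      rwa [Separates, h] at this
    obtain ⟨A, hA, rfl⟩ := W.exists_eq_mul_S m d hR' hm i hsep
    rw [map_mul, map_mul, mul_left_inj] at h
    rw [ih hA h]
  | mul_T x hx ih i =>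
    rw [ih (mul_mem hR' (W.T_mem i)) (by rw [map_mul, ← h, ← map_mul, mul_assoc, W.T_mul_self,
      mul_one]), mul_assoc, W.T_mul_self, mul_one]

theorem φ_injective : Function.Injective W.φ := by
  rw [injective_iff_map_eq_one]
  intro g hg
  obtain ⟨P, hP, Q, hQ, rfl⟩ := W.exists_eq_inv_mul g
  rw [map_mul, map_inv, inv_mul_eq_one] at hg
  rw [W.eq_of_φ_eq hP hQ hg, inv_mul_cancel]

end Model

section Presentation

variable {n : ℕ} {k : Fin n → ℕ} {s : ℕ → Fin n → Equiv.Perm (Sp n k)}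
  {t : ℕ → Equiv.Perm (Sp n k)}

theorem lift_SG (i : ℕ) (d : Fin n) : FreeGroup.lift (genMap s t) (SG i d) = s i d := by
  simp [SG, genMap]

theorem lift_TG (i : ℕ) : FreeGroup.lift (genMap s t) (TG i) = t i := by
  simp [TG, genMap]

theorem lift_rels (hk : ∀ d, 2 ≤ k d) (hs : ∀ i d p, s i d p = sMap k i d p)
    (ht : ∀ i p, t i p = tMap k i p) :
    ∀ w ∈ rels k s t, FreeGroup.lift (genMap s t) w = 1 := by
  have hT : ∀ i d, FreeGroup.lift (genMap s t) (tauTilde k i d) =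
      (((List.range (k d)).reverse).map fun m => t (i + m)).prod := by
    intro i d
    simp [tauTilde, map_list_prod, Function.comp_def, lift_TG]
  have hS : ∀ i r d, FreeGroup.lift (genMap s t)
      (((List.range r).map fun m => SG (i + m) d).prod) =
      ((List.range r).map fun m => s (i + m) d).prod := by
    intro i r d
    simp [map_list_prod, Function.comp_def, lift_SG]
  rintro w (((((((⟨i, j, d, d', hij, rfl⟩ | ⟨i, rfl⟩) | ⟨i, j, hij, rfl⟩) | ⟨i, rfl⟩) |
    ⟨i, j, d, hij, rfl⟩) | ⟨i, d, rfl⟩) | ⟨i, j, d, hij, rfl⟩) | ⟨i, d, d', a, hd, -, ha, rfl⟩) <;>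
    simp only [map_mul, map_inv, lift_SG, lift_TG, hT, hS]
  · rw [mul_inv_eq_one, s_mul_s hk hs hij]
  · exact t_mul_self ht i
  · rw [mul_inv_eq_one, t_comm ht hij]
  · rw [mul_inv_eq_one, t_braid ht]
  · rw [mul_inv_eq_one, s_mul_t_of_lt hk hs ht hij]
  · rw [mul_inv_eq_one, s_mul_t_self hs hk ht]
  · rw [mul_inv_eq_one, s_mul_t_of_gt hs ht hij]
  · rw [mul_inv_eq_one, prod_s_mul_s hk hs i hd _ ha]

/-- The presented group as a model. -/
def presentedModel (hk : ∀ d, 2 ≤ k d) (hs : ∀ i d p, s i d p = sMap k i d p)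
    (ht : ∀ i p, t i p = tMap k i p) : Model k (PresentedGroup (rels k s t)) where
  S i d := PresentedGroup.mk _ (SG i d)
  T i := PresentedGroup.mk _ (TG i)
  φ := PresentedGroup.toGroup (lift_rels hk hs ht)
  two_le := hk
  φ_S i d p := (congrArg (fun f : Equiv.Perm (Sp n k) => f p)
    (PresentedGroup.toGroup.of (lift_rels hk hs ht))).trans (hs i d p)
  φ_T i p := (congrArg (fun f : Equiv.Perm (Sp n k) => f p)
    (PresentedGroup.toGroup.of (lift_rels hk hs ht))).trans (ht i p)
  closure_eq := by
    rw [← top_le_iff, ← PresentedGroup.closure_range_of (rels k s t)]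
    refine Subgroup.closure_mono ?_
    rintro _ ⟨⟨i, d⟩ | i, rfl⟩
    · exact Or.inl ⟨i, d, rfl⟩
    · exact Or.inr ⟨i, rfl⟩
  S_mul_S hij d d' := PresentedGroup.mk_eq_mk_of_mul_inv_mem
    (.inl (.inl (.inl (.inl (.inl (.inl (.inl ⟨_, _, d, d', hij, rfl⟩)))))))
  T_mul_self i := PresentedGroup.one_of_mem (.inl (.inl (.inl (.inl (.inl (.inl (.inr ⟨i, rfl⟩)))))))
  T_comm hij := PresentedGroup.mk_eq_mk_of_mul_inv_mem
    (.inl (.inl (.inl (.inl (.inl (.inr ⟨_, _, .inl hij, rfl⟩))))))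
  T_braid i := PresentedGroup.mk_eq_mk_of_mul_inv_mem
    (.inl (.inl (.inl (.inl (.inr ⟨i, rfl⟩)))))
  S_mul_T_of_lt hij d := PresentedGroup.mk_eq_mk_of_mul_inv_mem
    (.inl (.inl (.inl (.inr ⟨_, _, d, hij, rfl⟩))))
  S_mul_T_self i d := by
    have h : PresentedGroup.mk (rels k s t) (SG i d * TG i) =
        PresentedGroup.mk (rels k s t) (tauTilde k i d * SG (i + 1) d) :=
      PresentedGroup.mk_eq_mk_of_mul_inv_mem (.inl (.inl (.inr ⟨i, d, rfl⟩)))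
    simpa [tauTilde, map_list_prod, Function.comp_def] using h
  S_mul_T_of_gt hij d := PresentedGroup.mk_eq_mk_of_mul_inv_mem
    (.inl (.inr ⟨_, _, d, hij, rfl⟩))
  prod_S_mul_S i {d d'} hd := by
    obtain ⟨a, ha, hap⟩ := exists_alpha (s := s) hk ht i d d'
    have h : PresentedGroup.mk (rels k s t)
          (((List.range (k d)).map fun m => SG (i + m) d').prod * SG i d) =
        PresentedGroup.mk (rels k s t)
          (a * ((List.range (k d')).map fun m => SG (i + m) d).prod * SG i d') :=
      PresentedGroup.mk_eq_mk_of_mul_inv_mem (.inr ⟨i, d, d', a, hd, ha, hap, rfl⟩)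
    refine ⟨PresentedGroup.mk _ a, ?_, ?_⟩
    · have h' := Subgroup.mem_map_of_mem (PresentedGroup.mk (rels k s t)) ha
      rw [MonoidHom.map_closure] at h'
      refine Subgroup.closure_mono ?_ h'
      rintro _ ⟨_, ⟨m, rfl⟩, rfl⟩
      exact ⟨m, rfl⟩
    · simpa [map_list_prod, Function.comp_def, mul_assoc] using h

end Presentation

end WGroup

theorem statement14 (n : ℕ) (hn : 2 ≤ n) (k : Fin n → ℕ) (hk : ∀ d, 2 ≤ k d)
    (s : ℕ → Fin n → Equiv.Perm (WGroup.Sp n k))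
    (t : ℕ → Equiv.Perm (WGroup.Sp n k))
    (hs : ∀ i d p, s i d p = WGroup.sMap k i d p)
    (ht : ∀ i p, t i p = WGroup.tMap k i p) :
    ∃ h : ∀ w ∈ WGroup.rels k s t, FreeGroup.lift (WGroup.genMap s t) w = 1,
      Function.Injective (PresentedGroup.toGroup h) ∧
      (PresentedGroup.toGroup h).range = Subgroup.closure (WGroup.gens k s t) := by
  refine ⟨WGroup.lift_rels hk hs ht, (WGroup.presentedModel hk hs ht).φ_injective, ?_⟩
  rw [MonoidHom.range_eq_map, ← PresentedGroup.closure_range_of, MonoidHom.map_closure,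
    ← Set.range_comp]
  congr 1
  ext g
  constructor
  · rintro ⟨⟨i, d⟩ | i, rfl⟩
    · exact Or.inl ⟨i, d, PresentedGroup.toGroup.of _⟩
    · exact Or.inr ⟨i, PresentedGroup.toGroup.of _⟩
  · rintro (⟨i, d, rfl⟩ | ⟨i, rfl⟩)
    · exact ⟨Sum.inl (i, d), PresentedGroup.toGroup.of _⟩
    · exact ⟨Sum.inr i, PresentedGroup.toGroup.of _⟩
end

section
/- Let k ≥ 2 and r ≥ 1, and let A_{k,r} be the r×r integer matrix whose (1,r) entry is k, whose (i+1,i) entries are 1 for 1 ≤ i ≤ r−1, and all of whose other entries are 0. Then the quotient group ℤ^r/(I − A_{k,r}^T)ℤ^r is cyclic of order k−1; more precisely, there is a group isomorphism ℤ^r/(I − A_{k,r}^T)ℤ^r → ℤ/(k−1)ℤ carrying the class of the vector (1,1,…,1) to the class of r. -/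
/-- The `r × r` matrix `A_{k,r}` whose `(1,r)` entry is `k`, whose `(i+1,i)` entries
are `1` for `1 ≤ i ≤ r-1`, and all of whose other entries are `0`
(indices taken `0`-based). -/
def Akr (k r : ℕ) : Matrix (Fin r) (Fin r) ℤ := fun i j =>
  if (i : ℕ) = 0 ∧ (j : ℕ) = r - 1 then (k : ℤ)
  else if (i : ℕ) = (j : ℕ) + 1 then 1
  else 0

theorem toLin'_one_sub_Akr_transpose_castSucc (k n : ℕ) (x : Fin (n + 1) → ℤ) (i : Fin n) :
    Matrix.toLin' (1 - (Akr k (n + 1)).transpose) x i.castSucc = x i.castSucc - x i.succ := by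
  have h : ∀ j : Fin (n + 1), Akr k (n + 1) j i.castSucc = if j = i.succ then 1 else 0 := by
    intro j
    have hi := i.isLt
    simp only [Akr, Fin.ext_iff, Fin.val_castSucc, Fin.val_succ]
    rw [if_neg (by omega)]
  simp [Matrix.toLin'_apply, Matrix.mulVec, dotProduct, h]

theorem toLin'_one_sub_Akr_transpose_last (k n : ℕ) (x : Fin (n + 1) → ℤ) :
    Matrix.toLin' (1 - (Akr k (n + 1)).transpose) x (Fin.last n) =
      x (Fin.last n) - k * x 0 := by
  have h : ∀ j : Fin (n + 1), Akr k (n + 1) j (Fin.last n) = if j = 0 then (k : ℤ) else 0 := by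
    intro j
    have hj := j.isLt
    simp only [Akr, Fin.ext_iff, Fin.val_last, Fin.val_zero]
    split_ifs <;> first | rfl | omega
  simp [Matrix.toLin'_apply, Matrix.mulVec, dotProduct, h]

theorem sum_toLin'_one_sub_Akr_transpose (k n : ℕ) (x : Fin (n + 1) → ℤ) :
    ∑ i, Matrix.toLin' (1 - (Akr k (n + 1)).transpose) x i = (1 - k) * x 0 := by
  rw [Fin.sum_univ_castSucc]
  simp only [toLin'_one_sub_Akr_transpose_castSucc, toLin'_one_sub_Akr_transpose_last,
    Finset.sum_sub_distrib]
  have h := (Fin.sum_univ_castSucc x).symm.trans (Fin.sum_univ_succ x)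
  linarith

/-- A vector lies in the image of `I - A_{k,r}ᵀ` exactly when `k - 1` divides the sum
of its coordinates. -/
theorem mem_range_toLin'_one_sub_Akr_transpose_iff (k n : ℕ) (y : Fin (n + 1) → ℤ) :
    y ∈ LinearMap.range (Matrix.toLin' (1 - (Akr k (n + 1)).transpose)) ↔
      (k - 1 : ℤ) ∣ ∑ i, y i := by
  constructor
  · rintro ⟨x, rfl⟩
    rw [sum_toLin'_one_sub_Akr_transpose]
    exact ⟨-x 0, by ring⟩
  · rintro ⟨t, ht⟩
    let x : Fin (n + 1) → ℤ :=
      Fin.induction (-t) fun i a => a - y i.castSucc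
    have hx : ∀ i : Fin n,
        Matrix.toLin' (1 - (Akr k (n + 1)).transpose) x i.castSucc = y i.castSucc := by
      intro i
      rw [toLin'_one_sub_Akr_transpose_castSucc]
      simp [x]
    refine ⟨x, funext fun i => ?_⟩
    induction i using Fin.lastCases with
    | cast i => exact hx i
    | last =>
      have hsum := sum_toLin'_one_sub_Akr_transpose k n x
      have hx0 : x 0 = -t := rfl
      rw [Fin.sum_univ_castSucc, Finset.sum_congr rfl fun i _ => hx i, hx0] at hsum
      rw [Fin.sum_univ_castSucc] at ht
      linarith

theorem statement15 (k r : ℕ) (hk : 2 ≤ k) (hr : 1 ≤ r) :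
    ∃ φ : ((Fin r → ℤ) ⧸
        LinearMap.range (Matrix.toLin' (1 - (Akr k r).transpose))) ≃+ ZMod (k - 1),
      φ (Submodule.Quotient.mk fun _ => 1) = (r : ZMod (k - 1)) := by
  obtain ⟨n, rfl⟩ : ∃ n, r = n + 1 := ⟨r - 1, by omega⟩
  let f : (Fin (n + 1) → ℤ) →ₗ[ℤ] ZMod (k - 1) :=
    (Int.castAddHom (ZMod (k - 1))).toIntLinearMap ∘ₗ ∑ i, LinearMap.proj i
  have hf : ∀ y, f y = ((∑ i, y i : ℤ) : ZMod (k - 1)) := fun y => by simp [f]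
  have hsurj : Function.Surjective f := fun a => by
    obtain ⟨m, rfl⟩ := ZMod.intCast_surjective a
    exact ⟨Pi.single 0 m, by rw [hf, Finset.sum_pi_single']; simp⟩
  have hker : LinearMap.range (Matrix.toLin' (1 - (Akr k (n + 1)).transpose)) =
      LinearMap.ker f := by
    ext y
    rw [mem_range_toLin'_one_sub_Akr_transpose_iff, LinearMap.mem_ker, hf,
      ZMod.intCast_zmod_eq_zero_iff_dvd, Nat.cast_sub (by omega), Nat.cast_one]
  refine ⟨((Submodule.quotEquivOfEq _ _ hker).trans
    (f.quotKerEquivOfSurjective hsurj)).toAddEquiv, ?_⟩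
  change f (fun _ => 1) = _
  rw [hf]
  simp
end

section
/- Let A be an N×N matrix with entries in ℕ ∪ {0} which is irreducible (for all indices ξ, η there exists n ≥ 1 with (A^n)(ξ,η) > 0) and is not a permutation matrix. Then there exist M ≥ 1 and an M×M matrix B with entries in ℕ ∪ {0} which is primitive (there exists n ≥ 1 such that every entry of B^n is positive) and not a permutation matrix, together with a group isomorphism Φ : ℤ^N/(I − A^T)ℤ^N → ℤ^M/(I − B^T)ℤ^M such that Φ sends the class of (1,1,…,1) ∈ ℤ^N to the class of (1,1,…,1) ∈ ℤ^M, and such that sgn(det(I − A)) = sgn(det(I − B)). -/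
/-- A square matrix with entries in `ℕ` is a permutation matrix if it has exactly
one `1` in each row, placed according to a permutation, and `0`s elsewhere. -/
def IsPermutationMatrix {N : ℕ} (A : Matrix (Fin N) (Fin N) ℕ) : Prop :=
  ∃ σ : Equiv.Perm (Fin N), ∀ i j, A i j = if σ i = j then 1 else 0

/-- A square matrix with entries in `ℕ` is irreducible if for all indices `ξ, η`
there exists `n ≥ 1` with `(A^n)(ξ,η) > 0`. -/
def IsIrreducibleMatrix {N : ℕ} (A : Matrix (Fin N) (Fin N) ℕ) : Prop :=
  ∀ ξ η, ∃ n : ℕ, 1 ≤ n ∧ 0 < (A ^ n) ξ η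

/-- A square matrix with entries in `ℕ` is primitive if there exists `n ≥ 1` such
that every entry of `A^n` is positive. -/
def IsPrimitiveMatrix {N : ℕ} (A : Matrix (Fin N) (Fin N) ℕ) : Prop :=
  ∃ n : ℕ, 1 ≤ n ∧ ∀ i j, 0 < (A ^ n) i j

/-- The Bowen–Franks group `BF(Aᵀ) = ℤ^N/(I − Aᵀ)ℤ^N` of a square matrix `A`
with entries in `ℕ`. -/
abbrev BFt {N : ℕ} (A : Matrix (Fin N) (Fin N) ℕ) : Type :=
  (Fin N → ℤ) ⧸
    LinearMap.range (Matrix.toLin' (1 - (A.map (Nat.cast : ℕ → ℤ)).transpose))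

section Walks

variable {N : ℕ} {A : Matrix (Fin N) (Fin N) ℕ}

theorem pow_add_apply_pos {m n : ℕ} {a b c : Fin N} (h₁ : 0 < (A ^ m) a b)
    (h₂ : 0 < (A ^ n) b c) : 0 < (A ^ (m + n)) a c := by
  rw [pow_add, Matrix.mul_apply]
  exact Finset.sum_pos' (fun _ _ => Nat.zero_le _) ⟨b, Finset.mem_univ _, Nat.mul_pos h₁ h₂⟩

theorem exists_of_pow_succ_apply_pos {n : ℕ} {a b : Fin N} (h : 0 < (A ^ (n + 1)) a b) :
    ∃ c, 0 < A a c ∧ 0 < (A ^ n) c b := by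
  rw [pow_succ', Matrix.mul_apply] at h
  obtain ⟨c, -, hc⟩ := Finset.exists_ne_zero_of_sum_ne_zero h.ne'
  exact ⟨c, Nat.pos_of_ne_zero (left_ne_zero_of_mul hc),
    Nat.pos_of_ne_zero (right_ne_zero_of_mul hc)⟩

theorem pow_one_apply_pos {a b : Fin N} (h : 0 < A a b) : 0 < (A ^ 1) a b := by
  rwa [pow_one]

/-- An irreducible matrix with a positive diagonal entry is primitive. -/
theorem IsIrreducibleMatrix.isPrimitiveMatrix_of_diag_pos (hA : IsIrreducibleMatrix A)
    {i : Fin N} (hi : 0 < A i i) : IsPrimitiveMatrix A := by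
  have loop : ∀ n, 0 < (A ^ n) i i := by
    intro n
    induction n with
    | zero => simp
    | succ n ih => exact pow_add_apply_pos ih (pow_one_apply_pos hi)
  choose f _ hf using fun a => hA a i
  choose g _ hg using fun b => hA i b
  refine ⟨1 + ∑ a, f a + ∑ b, g b, by omega, fun a b => ?_⟩
  have ha : f a ≤ ∑ a, f a := Finset.single_le_sum (fun _ _ => Nat.zero_le _) (Finset.mem_univ a)
  have hb : g b ≤ ∑ b, g b := Finset.single_le_sum (fun _ _ => Nat.zero_le _) (Finset.mem_univ b)
  have := pow_add_apply_pos (pow_add_apply_pos (hf a)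
    (loop (1 + (∑ a, f a - f a) + (∑ b, g b - g b)))) (hg b)
  rwa [show f a + (1 + (∑ a, f a - f a) + (∑ b, g b - g b)) + g b =
    1 + ∑ a, f a + ∑ b, g b by omega] at this

/-- An irreducible matrix whose columns all sum to at most `1` is a permutation matrix. -/
theorem IsIrreducibleMatrix.isPermutationMatrix_of_colSum_le_one (hA : IsIrreducibleMatrix A)
    (h : ∀ j, ∑ i, A i j ≤ 1) : IsPermutationMatrix A := by
  have row : ∀ i, ∃ j, 0 < A i j := by
    intro i
    obtain ⟨n, hn, hp⟩ := hA i i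
    obtain ⟨m, rfl⟩ := Nat.exists_eq_add_of_le' hn
    obtain ⟨c, hc, -⟩ := exists_of_pow_succ_apply_pos hp
    exact ⟨c, hc⟩
  have two : ∀ {i i' j}, i ≠ i' → A i j + A i' j ≤ 1 := by
    intro i i' j hne
    rw [← Finset.sum_pair (f := fun i => A i j) hne]
    exact (Finset.sum_le_sum_of_subset (Finset.subset_univ _)).trans (h j)
  choose s hs using row
  have inj : Function.Injective s := by
    intro i i' hii
    by_contra hne
    have h₁ := hs i
    have h₂ := hs i'
    rw [← hii] at h₂
    have := two (j := s i) hne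
    omega
  let σ := Equiv.ofBijective s (Finite.injective_iff_bijective.mp inj)
  refine ⟨σ, fun i j => ?_⟩
  have hj : 0 < A (σ.symm j) j := by
    have := hs (σ.symm j)
    rwa [show s (σ.symm j) = j from σ.apply_symm_apply j] at this
  split_ifs with hij
  · obtain rfl : i = σ.symm j := by simp [← hij]
    have : A (σ.symm j) j ≤ 1 := (Finset.single_le_sum (f := fun i => A i j)
      (fun _ _ => Nat.zero_le _) (Finset.mem_univ (σ.symm j))).trans (h j)
    omega
  · have hne : i ≠ σ.symm j := fun e => hij (by simp [e])
    have := two (j := j) hne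
    omega

theorem IsPermutationMatrix.colSum_eq_one (hA : IsPermutationMatrix A) (j : Fin N) :
    ∑ i, A i j = 1 := by
  obtain ⟨σ, hσ⟩ := hA
  simp [hσ, ← Equiv.eq_symm_apply]

end Walks

section EdgeExpansion

open Matrix

variable {N : ℕ}

/-- The matrix obtained from `A` by replacing one edge `k → i` by the edges `k → j`, one for
each edge `i → j`. -/
def edgeExpansion (A : Matrix (Fin N) (Fin N) ℕ) (k i : Fin N) : Matrix (Fin N) (Fin N) ℕ :=
  fun a c => if a = k then A k c - (if c = i then 1 else 0) + A i c else A a c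

variable {A : Matrix (Fin N) (Fin N) ℕ} {k i : Fin N}

theorem edgeExpansion_of_ne {a : Fin N} (h : a ≠ k) (c : Fin N) :
    edgeExpansion A k i a c = A a c := by
  simp [edgeExpansion, h]

theorem edgeExpansion_self (c : Fin N) :
    edgeExpansion A k i k c = A k c - (if c = i then 1 else 0) + A i c := by
  simp [edgeExpansion]

theorem le_edgeExpansion_self (c : Fin N) : A i c ≤ edgeExpansion A k i k c := by
  rw [edgeExpansion_self]
  omega

theorem le_edgeExpansion {a c : Fin N} (h : a ≠ k ∨ c ≠ i) :
    A a c ≤ edgeExpansion A k i a c := by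
  by_cases ha : a = k
  · subst ha
    have hc : c ≠ i := by simpa using h
    simp [edgeExpansion_self, hc]
  · rw [edgeExpansion_of_ne ha]

theorem one_sub_edgeExpansion (hki : 0 < A k i) :
    1 - (edgeExpansion A k i).map (Nat.cast : ℕ → ℤ) =
      transvection k i 1 * (1 - A.map (Nat.cast : ℕ → ℤ)) := by
  ext a c
  by_cases ha : a = k
  · subst ha
    rw [transvection_mul_apply_same]
    simp only [Matrix.sub_apply, map_apply, edgeExpansion_self, one_apply]
    by_cases hc : c = i
    · subst hc
      simp only [if_true]
      push_cast [Nat.cast_sub (show 1 ≤ A a c from hki)]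
      ring
    · simp only [hc, Ne.symm hc, if_false]
      push_cast
      simp
      ring
  · rw [transvection_mul_apply_of_ne _ _ _ _ ha]
    simp [edgeExpansion_of_ne ha]

theorem det_one_sub_edgeExpansion (hne : k ≠ i) (hki : 0 < A k i) :
    (1 - (edgeExpansion A k i).map (Nat.cast : ℕ → ℤ)).det =
      (1 - A.map (Nat.cast : ℕ → ℤ)).det := by
  rw [one_sub_edgeExpansion hki, det_mul, det_transvection_of_ne _ _ hne, one_mul]

theorem range_one_sub_edgeExpansion (hne : k ≠ i) (hki : 0 < A k i) :
    LinearMap.range (toLin' (1 - ((edgeExpansion A k i).map (Nat.cast : ℕ → ℤ))ᵀ)) =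
      LinearMap.range (toLin' (1 - (A.map (Nat.cast : ℕ → ℤ))ᵀ)) := by
  have h := congrArg transpose (one_sub_edgeExpansion hki)
  simp only [transpose_sub, transpose_one, transpose_mul] at h
  rw [h, toLin'_mul]
  refine LinearMap.range_comp_of_range_eq_top _ (LinearMap.range_eq_top.mpr ?_)
  intro v
  refine ⟨(transvection k i (-1))ᵀ *ᵥ v, ?_⟩
  rw [toLin'_apply, mulVec_mulVec, ← transpose_mul, transvection_mul_transvection_same _ _ hne]
  simp

/-- Walks not ending at `i` survive the expansion of an edge `k → i`, possibly shortened. -/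
theorem exists_edgeExpansion_walk (hi : A i i = 0) {b : Fin N} (hb : b ≠ i) :
    ∀ (m : ℕ) (a : Fin N), 0 < (A ^ m) a b →
      ∃ m' ≤ m, (1 ≤ m → 1 ≤ m') ∧ 0 < (edgeExpansion A k i ^ m') a b := by
  intro m
  induction m using Nat.strong_induction_on with
  | _ m ih =>
    intro a h
    rcases m with _ | m
    · exact ⟨0, le_rfl, id, by simpa using h⟩
    obtain ⟨c, hac, hcb⟩ := exists_of_pow_succ_apply_pos h
    by_cases hedge : a ≠ k ∨ c ≠ i
    · obtain ⟨m', hm', -, hw⟩ := ih m (by omega) c hcb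
      exact ⟨1 + m', by omega, by omega,
        pow_add_apply_pos (pow_one_apply_pos (hac.trans_le (le_edgeExpansion hedge))) hw⟩
    · obtain ⟨rfl, rfl⟩ : a = k ∧ c = i := by simpa [not_or] using hedge
      rcases m with _ | m
      · simp [one_apply, hb.symm] at hcb
      obtain ⟨d, hd, hdb⟩ := exists_of_pow_succ_apply_pos hcb
      obtain ⟨m', hm', -, hw⟩ := ih m (by omega) d hdb
      exact ⟨1 + m', by omega, by omega,
        pow_add_apply_pos (pow_one_apply_pos (hd.trans_le (le_edgeExpansion_self d))) hw⟩

theorem IsIrreducibleMatrix.isIrreducibleMatrix_edgeExpansion (hA : IsIrreducibleMatrix A)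
    (hi : A i i = 0) (hne : k ≠ i) (hcol : 2 ≤ ∑ a, A a i) :
    IsIrreducibleMatrix (edgeExpansion A k i) := by
  have walk : ∀ a b, b ≠ i → ∃ n, 1 ≤ n ∧ 0 < (edgeExpansion A k i ^ n) a b := by
    intro a b hb
    obtain ⟨n, hn, hp⟩ := hA a b
    obtain ⟨m, -, hm, hw⟩ := exists_edgeExpansion_walk (k := k) hi hb n a hp
    exact ⟨m, hm hn, hw⟩
  intro a b
  by_cases hb : b = i
  · subst hb
    obtain ⟨c, hc, hcb⟩ : ∃ c, c ≠ b ∧ 0 < edgeExpansion A k b c b := by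
      by_cases hk : 2 ≤ A k b
      · refine ⟨k, hne, ?_⟩
        rw [edgeExpansion_self, if_pos rfl]
        omega
      · rw [← Finset.add_sum_erase _ _ (Finset.mem_univ k)] at hcol
        obtain ⟨c, hc, hcb⟩ := Finset.exists_ne_zero_of_sum_ne_zero
          (show ∑ a ∈ Finset.univ.erase k, A a b ≠ 0 by omega)
        have hck := Finset.ne_of_mem_erase hc
        refine ⟨c, ?_, ?_⟩
        · rintro rfl
          exact hcb hi
        · rw [edgeExpansion_of_ne hck]
          omega
    obtain ⟨n, hn, hw⟩ := walk a c hc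
    exact ⟨n + 1, by omega, pow_add_apply_pos hw (pow_one_apply_pos hcb)⟩
  · exact walk a b hb

/-- An irreducible matrix with a closed walk through a vertex of in-degree at least two can be
turned into a primitive one without changing the row lattice of `1 - A` or its determinant. -/
theorem IsIrreducibleMatrix.exists_isPrimitiveMatrix (n : ℕ) :
    ∀ (A : Matrix (Fin N) (Fin N) ℕ) (i : Fin N), IsIrreducibleMatrix A →
      2 ≤ ∑ a, A a i → 1 ≤ n → 0 < (A ^ n) i i →
      ∃ B : Matrix (Fin N) (Fin N) ℕ, IsPrimitiveMatrix B ∧ ¬ IsPermutationMatrix B ∧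
        LinearMap.range (toLin' (1 - (B.map (Nat.cast : ℕ → ℤ))ᵀ)) =
          LinearMap.range (toLin' (1 - (A.map (Nat.cast : ℕ → ℤ))ᵀ)) ∧
        (1 - B.map (Nat.cast : ℕ → ℤ)).det = (1 - A.map (Nat.cast : ℕ → ℤ)).det := by
  induction n using Nat.strong_induction_on with
  | _ n ih =>
    intro A i hA hcol hn hw
    by_cases hi : A i i = 0
    · obtain ⟨n, rfl⟩ := Nat.exists_eq_add_of_le' hn
      obtain ⟨j, hij, hji⟩ := exists_of_pow_succ_apply_pos hw
      rcases n with _ | n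
      · rw [zero_add, pow_one] at hw
        omega
      obtain ⟨k, hjk, hki⟩ : ∃ k, 0 < (A ^ n) j k ∧ 0 < A k i := by
        rw [pow_succ, Matrix.mul_apply] at hji
        obtain ⟨k, -, hk⟩ := Finset.exists_ne_zero_of_sum_ne_zero hji.ne'
        exact ⟨k, Nat.pos_of_ne_zero (left_ne_zero_of_mul hk),
          Nat.pos_of_ne_zero (right_ne_zero_of_mul hk)⟩
      have hne : k ≠ i := by
        rintro rfl
        omega
      obtain ⟨m, hm, -, hjk'⟩ := exists_edgeExpansion_walk (k := k) hi hne n j hjk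
      have hkj := hij.trans_le (le_edgeExpansion_self (A := A) (k := k) (i := i) j)
      have hcol' : 2 ≤ ∑ a, edgeExpansion A k i a j := by
        have hij' : 0 < edgeExpansion A k i i j := by rwa [edgeExpansion_of_ne hne.symm]
        have := Finset.sum_le_sum_of_subset (f := fun a => edgeExpansion A k i a j)
          (Finset.subset_univ {k, i})
        rw [Finset.sum_pair hne] at this
        omega
      obtain ⟨B, hB, hBp, hBr, hBd⟩ := ih (m + 1) (by omega) _ j
        (hA.isIrreducibleMatrix_edgeExpansion hi hne hcol) hcol' (by omega)
        (pow_add_apply_pos hjk' (pow_one_apply_pos hkj))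
      exact ⟨B, hB, hBp, hBr.trans (range_one_sub_edgeExpansion hne hki),
        hBd.trans (det_one_sub_edgeExpansion hne hki)⟩
    · refine ⟨A, hA.isPrimitiveMatrix_of_diag_pos (Nat.pos_of_ne_zero hi), fun hp => ?_, rfl, rfl⟩
      rw [hp.colSum_eq_one] at hcol
      omega

end EdgeExpansion

theorem statement16 (N : ℕ) (A : Matrix (Fin N) (Fin N) ℕ)
    (hirr : IsIrreducibleMatrix A) (hnp : ¬ IsPermutationMatrix A) :
    ∃ (M : ℕ), 1 ≤ M ∧ ∃ B : Matrix (Fin M) (Fin M) ℕ,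
      IsPrimitiveMatrix B ∧ ¬ IsPermutationMatrix B ∧
      (∃ Φ : BFt A ≃+ BFt B,
        Φ (Submodule.Quotient.mk fun _ => 1) = Submodule.Quotient.mk fun _ => 1) ∧
      Int.sign (Matrix.det (1 - A.map (Nat.cast : ℕ → ℤ))) =
        Int.sign (Matrix.det (1 - B.map (Nat.cast : ℕ → ℤ))) := by
  obtain ⟨i, hi⟩ : ∃ i, 2 ≤ ∑ a, A a i := by
    by_contra! h
    exact hnp (hirr.isPermutationMatrix_of_colSum_le_one fun j => Nat.le_of_lt_succ (h j))
  obtain ⟨n, hn, hw⟩ := hirr i i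
  obtain ⟨B, hB, hBp, hBr, hBd⟩ :=
    IsIrreducibleMatrix.exists_isPrimitiveMatrix n A i hirr hi hn hw
  exact ⟨N, i.pos, B, hB, hBp, ⟨(Submodule.quotEquivOfEq _ _ hBr.symm).toAddEquiv, rfl⟩,
    by rw [hBd]⟩
end
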